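/- Let G : I × [0,1] → I be a C² family of C² unimodal maps g_t of I = [-1,1] such that g_0 has a parabolic periodic point p (period k ≥ 1, |(g_0^k)'(p)| = 1) whose orbit attracts the critical orbit of g_0 but is disjoint from it. Then, with h(t) the topological entropy of g_t, there exist c > 0 and t₀ > 0 such that for all t ∈ (0, t₀], |h(t) − h(0)| ≤ exp(−c · t^{−1/2}). -/

import Mathlib

open Filter Set MeasureTheory

/-- Topological entropy of a map `g` on a set `s`. -/
noncomputable def entropyOn (g : ℝ → ℝ) (s : Set ℝ) : ℝ :=
  (Dynamics.coverEntropy g s).toReal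

/-- `g` is a C² unimodal map of `I = [-1,1]` with turning point `c`:
`g` maps `I` into `I` and `∂I` into `∂I`, is C² on `I`, its derivative vanishes on `I`
exactly at `c`, and `g` is strictly monotone on each side of `c` (in opposite directions). -/
def C2UnimodalWith (g : ℝ → ℝ) (c : ℝ) : Prop :=
  c ∈ Set.Ioo (-1 : ℝ) 1 ∧
  Set.MapsTo g (Set.Icc (-1 : ℝ) 1) (Set.Icc (-1 : ℝ) 1) ∧
  g (-1) ∈ ({-1, 1} : Set ℝ) ∧ g 1 ∈ ({-1, 1} : Set ℝ) ∧
  ContDiffOn ℝ 2 g (Set.Icc (-1 : ℝ) 1) ∧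
  (∀ x ∈ Set.Icc (-1 : ℝ) 1, (deriv g x = 0 ↔ x = c)) ∧
  ((StrictMonoOn g (Set.Icc (-1 : ℝ) c) ∧ StrictAntiOn g (Set.Icc c 1)) ∨
    (StrictAntiOn g (Set.Icc (-1 : ℝ) c) ∧ StrictMonoOn g (Set.Icc c 1)))

/-- A continuous unimodal map of `[-1,1]` with turning point `c`, increasing on `[-1,c]`. -/
structure IsUnimodalMax (f : ℝ → ℝ) (c : ℝ) : Prop where
  mem : c ∈ Ioo (-1 : ℝ) 1
  mapsTo : MapsTo f (Icc (-1 : ℝ) 1) (Icc (-1 : ℝ) 1)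
  cont : ContinuousOn f (Icc (-1 : ℝ) 1)
  left : f (-1) = -1
  right : f 1 = -1
  mono : StrictMonoOn f (Icc (-1 : ℝ) c)
  anti : StrictAntiOn f (Icc c 1)

/-- The itinerary of length `n` of `x` with respect to the turning point `c`. -/
noncomputable def itinerary (f : ℝ → ℝ) (c : ℝ) (n : ℕ) (x : ℝ) : Fin n → SignType :=
  fun i => SignType.sign (f^[i] x - c)

/-- The number of itineraries of length `n` realized by points of `[-1,1]`. -/
noncomputable def itineraryCount (f : ℝ → ℝ) (c : ℝ) (n : ℕ) : ℕ :=
  (itinerary f c n '' Icc (-1 : ℝ) 1).ncard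

/-- The points of `[-1,1]` that hit the turning point before time `n`. -/
def precritical (f : ℝ → ℝ) (c : ℝ) (n : ℕ) : Set ℝ :=
  {z | z ∈ Icc (-1 : ℝ) 1 ∧ ∃ i < n, f^[i] z = c}

namespace IsUnimodalMax

variable {f : ℝ → ℝ} {c : ℝ}

theorem mapsTo_iterate (hf : IsUnimodalMax f c) (n : ℕ) :
    MapsTo f^[n] (Icc (-1 : ℝ) 1) (Icc (-1 : ℝ) 1) := hf.mapsTo.iterate n

theorem continuousOn_iterate (hf : IsUnimodalMax f c) (n : ℕ) :
    ContinuousOn f^[n] (Icc (-1 : ℝ) 1) := hf.cont.iterate hf.mapsTo n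

theorem mem_Icc (hf : IsUnimodalMax f c) : c ∈ Icc (-1 : ℝ) 1 := Ioo_subset_Icc_self hf.mem

theorem Icc_eq (hf : IsUnimodalMax f c) : Icc (-1 : ℝ) 1 = Icc (-1) c ∪ Icc c 1 :=
  (Icc_union_Icc_eq_Icc hf.mem.1.le hf.mem.2.le).symm

theorem finite_preimage (hf : IsUnimodalMax f c) {S : Set ℝ} (hS : S.Finite) :
    {x | x ∈ Icc (-1 : ℝ) 1 ∧ f x ∈ S}.Finite := by
  have h1 : {x | x ∈ Icc (-1 : ℝ) c ∧ f x ∈ S}.Finite :=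
    Finite.of_finite_image (hS.subset (by rintro _ ⟨x, hx, rfl⟩; exact hx.2))
      (hf.mono.injOn.mono fun x hx => hx.1)
  have h2 : {x | x ∈ Icc c 1 ∧ f x ∈ S}.Finite :=
    Finite.of_finite_image (hS.subset (by rintro _ ⟨x, hx, rfl⟩; exact hx.2))
      (hf.anti.injOn.mono fun x hx => hx.1)
  refine (h1.union h2).subset fun x hx => ?_
  have := hx.1
  rw [hf.Icc_eq] at this
  exact this.imp (fun h => ⟨h, hx.2⟩) fun h => ⟨h, hx.2⟩

theorem finite_iterate_eq (hf : IsUnimodalMax f c) (n : ℕ) :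
    {x | x ∈ Icc (-1 : ℝ) 1 ∧ f^[n] x = c}.Finite := by
  induction n with
  | zero => exact (finite_singleton c).subset fun x hx => hx.2
  | succ n ih =>
    refine (hf.finite_preimage ih).subset fun x hx => ⟨hx.1, hf.mapsTo hx.1, ?_⟩
    simpa [Function.iterate_succ_apply] using hx.2

theorem finite_precritical (hf : IsUnimodalMax f c) (n : ℕ) : (precritical f c n).Finite := by
  refine ((finite_Iio n).biUnion fun i _ => hf.finite_iterate_eq i).subset ?_
  rintro x ⟨hx, i, hi, h⟩
  exact mem_biUnion (x := i) hi ⟨hx, h⟩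

/-- Points that are not separated by a precritical point have the same itinerary. -/
theorem itinerary_eq (hf : IsUnimodalMax f c) {n : ℕ} {x y : ℝ} (hx : x ∈ Icc (-1 : ℝ) 1)
    (hy : y ∈ Icc (-1 : ℝ) 1) (h : ∀ z ∈ uIcc x y, z ∉ precritical f c n) :
    itinerary f c n x = itinerary f c n y := by
  have hsub : uIcc x y ⊆ Icc (-1 : ℝ) 1 := uIcc_subset_Icc hx hy
  ext1 i
  have hno : c ∉ f^[i] '' uIcc x y := by
    rintro ⟨z, hz, hzc⟩
    exact h z hz ⟨hsub hz, i, i.2, hzc⟩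
  have hc := intermediate_value_uIcc ((hf.continuousOn_iterate i).mono hsub)
  have hno' : c ∉ uIcc (f^[i] x) (f^[i] y) := fun h => hno (hc h)
  have : (f^[i] x < c ∧ f^[i] y < c) ∨ (c < f^[i] x ∧ c < f^[i] y) := by
    rw [mem_uIcc] at hno'
    by_contra hcon
    apply hno'
    grind
  unfold itinerary
  rcases this with ⟨h1, h2⟩ | ⟨h1, h2⟩
  · rw [sign_neg (by linarith), sign_neg (by linarith)]
  · rw [sign_pos (by linarith), sign_pos (by linarith)]

end IsUnimodalMax

theorem ncard_itinerary_add_le (f : ℝ → ℝ) (c : ℝ) (a b : ℕ) (S : Set ℝ) :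
    (itinerary f c (a + b) '' S).ncard ≤
      (itinerary f c a '' S).ncard * (itinerary f c b '' (f^[a] '' S)).ncard := by
  rw [← ncard_prod]
  refine ncard_le_ncard_of_injOn
    (fun w => (fun i => w (Fin.castAdd b i), fun i => w (Fin.natAdd a i))) ?_ ?_ (toFinite _)
  · rintro _ ⟨x, hx, rfl⟩
    refine ⟨⟨x, hx, rfl⟩, ⟨f^[a] x, ⟨x, hx, rfl⟩, ?_⟩⟩
    ext1 i
    simp [itinerary, ← Function.iterate_add_apply, add_comm]
  · intro w _ w' _ h
    simp only [Prod.mk.injEq, funext_iff] at h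
    ext1 i
    exact Fin.addCases h.1 h.2 i

theorem itineraryCount_le (f : ℝ → ℝ) (c : ℝ) (n : ℕ) : itineraryCount f c n ≤ 3 ^ n := by
  refine (ncard_le_ncard (subset_univ _) (toFinite _)).trans ?_
  rw [ncard_univ, Nat.card_eq_fintype_card]
  simp
  rfl

theorem itineraryCount_pos (f : ℝ → ℝ) (c : ℝ) (n : ℕ) : 0 < itineraryCount f c n := by
  rw [itineraryCount, ncard_pos (toFinite _)]
  exact ⟨_, 0, by norm_num, rfl⟩

namespace IsUnimodalMax

variable {f : ℝ → ℝ} {c : ℝ}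

theorem itineraryCount_add_le (hf : IsUnimodalMax f c) (a b : ℕ) :
    itineraryCount f c (a + b) ≤ itineraryCount f c a * itineraryCount f c b := by
  refine (ncard_itinerary_add_le f c a b _).trans (Nat.mul_le_mul_left _ ?_)
  exact ncard_le_ncard (image_mono (hf.mapsTo_iterate a).image_subset) (toFinite _)

theorem itineraryCount_mul_le (hf : IsUnimodalMax f c) (m n : ℕ) :
    itineraryCount f c (m * n) ≤ itineraryCount f c m ^ n := by
  induction n with
  | zero => simpa using itineraryCount_le f c 0
  | succ n ih =>
    rw [mul_add_one, pow_succ]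
    exact (hf.itineraryCount_add_le _ _).trans (Nat.mul_le_mul_right _ ih)

/-- Short intervals realize at most three itineraries of a given length. -/
theorem exists_ncard_itinerary_ball_le (hf : IsUnimodalMax f c) (m : ℕ) :
    ∃ ε > 0, ∀ y : ℝ, (itinerary f c m '' (Icc (-1 : ℝ) 1 ∩ Metric.ball y ε)).ncard ≤ 3 := by
  have hK := hf.finite_precritical m
  have hev : ∀ᶠ ε : ℝ in nhdsWithin 0 (Ioi 0),
      ∀ q ∈ precritical f c m ×ˢ precritical f c m, q.1 ≠ q.2 → 2 * ε < dist q.1 q.2 := by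
    refine (hK.prod hK).eventually_all.2 fun q _ => ?_
    by_cases hq : q.1 = q.2
    · simp [hq]
    · have : (0 : ℝ) < dist q.1 q.2 / 2 := by have := dist_pos.2 hq; linarith
      filter_upwards [Ioo_mem_nhdsGT this] with ε hε _
      linarith [hε.2]
  obtain ⟨ε, hε, hε0⟩ := (hev.and self_mem_nhdsWithin).exists
  refine ⟨ε, hε0, fun y => ?_⟩
  set B := Icc (-1 : ℝ) 1 ∩ Metric.ball y ε with hB
  have hBord : ∀ x ∈ B, ∀ x' ∈ B, uIcc x x' ⊆ B := by
    intro x hx x' hx'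
    refine subset_inter (uIcc_subset_Icc hx.1 hx'.1) ?_
    have := (convex_ball y ε).ordConnected.uIcc_subset hx.2 hx'.2
    exact this
  obtain ⟨k, hk⟩ : ∃ k, ∀ z ∈ B, z ∈ precritical f c m → z = k := by
    by_cases hne : ∃ k ∈ B, k ∈ precritical f c m
    · obtain ⟨k, hkB, hk⟩ := hne
      refine ⟨k, fun z hz hzK => ?_⟩
      by_contra hzk
      have h1 := hε (z, k) ⟨hzK, hk⟩ hzk
      have h2 := Metric.mem_ball.1 hz.2
      have h3 := Metric.mem_ball'.1 hkB.2
      have := dist_triangle z y k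
      simp only at h1
      linarith
    · push Not at hne
      exact ⟨y, fun z hz hzK => absurd hzK (hne z hz)⟩
  have hsub : ∀ S ⊆ B, (∀ x ∈ S, ∀ x' ∈ S, k ∉ uIcc x x') → (itinerary f c m '' S).ncard ≤ 1 := by
    intro S hS hSk
    refine ncard_le_one_iff_subsingleton.2 ?_
    rintro _ ⟨x, hx, rfl⟩ _ ⟨x', hx', rfl⟩
    refine hf.itinerary_eq (hS hx).1 (hS hx').1 fun z hz hzK => ?_
    have := hk z (hBord x (hS hx) x' (hS hx') hz) hzK
    exact hSk x hx x' hx' (this ▸ hz)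
  have hcov : itinerary f c m '' B ⊆ itinerary f c m '' (B ∩ Iio k) ∪
      (itinerary f c m '' {k} ∪ itinerary f c m '' (B ∩ Ioi k)) := by
    rw [← image_union, ← image_union]
    refine image_mono fun x hx => ?_
    rcases lt_trichotomy x k with h | h | h
    · exact Or.inl ⟨hx, h⟩
    · exact Or.inr (Or.inl h)
    · exact Or.inr (Or.inr ⟨hx, h⟩)
  have h1 := hsub (B ∩ Iio k) inter_subset_left (by
    intro x hx x' hx' h
    have := hx.2; have := hx'.2
    simp only [mem_uIcc, mem_Iio] at *
    grind)
  have h2 := hsub (B ∩ Ioi k) inter_subset_left (by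
    intro x hx x' hx' h
    have := hx.2; have := hx'.2
    simp only [mem_uIcc, mem_Ioi] at *
    grind)
  have h3 := ncard_le_ncard hcov (toFinite _)
  have h4 := ncard_union_le (itinerary f c m '' (B ∩ Iio k))
    (itinerary f c m '' {k} ∪ itinerary f c m '' (B ∩ Ioi k))
  have h5 := ncard_union_le (itinerary f c m '' {k}) (itinerary f c m '' (B ∩ Ioi k))
  have h6 : (itinerary f c m '' {k}).ncard = 1 := by simp
  omega

theorem ncard_itinerary_blocks_le (hf : IsUnimodalMax f c) {m : ℕ} {B : ℕ → Set ℝ}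
    (hB : ∀ j, (itinerary f c m '' (Icc (-1 : ℝ) 1 ∩ B j)).ncard ≤ 3) (n : ℕ) :
    (itinerary f c (m * n) '' {x | x ∈ Icc (-1 : ℝ) 1 ∧ ∀ j < n, f^[m * j] x ∈ B j}).ncard
      ≤ 3 ^ n := by
  induction n with
  | zero =>
    refine (ncard_le_ncard (subset_univ _) (toFinite _)).trans ?_
    rw [ncard_univ, Nat.card_eq_fintype_card]
    simp
  | succ n ih =>
    rw [mul_add_one, pow_succ]
    refine (ncard_itinerary_add_le f c _ _ _).trans (Nat.mul_le_mul ?_ ?_)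
    · refine le_trans (ncard_le_ncard (image_mono fun x hx => ?_) (toFinite _)) ih
      exact ⟨hx.1, fun j hj => hx.2 j (by omega)⟩
    · refine le_trans (ncard_le_ncard (image_mono ?_) (toFinite _)) (hB n)
      rintro _ ⟨x, hx, rfl⟩
      exact ⟨hf.mapsTo_iterate _ hx.1, hx.2 n (by omega)⟩

open Dynamics in
theorem itineraryCount_le_of_isDynCoverOf (hf : IsUnimodalMax f c) {m : ℕ} {ε : ℝ}
    (hε : ∀ y : ℝ, (itinerary f c m '' (Icc (-1 : ℝ) 1 ∩ Metric.ball y ε)).ncard ≤ 3)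
    (hm : 1 ≤ m) (n : ℕ) (s : Finset ℝ)
    (hs : IsDynCoverOf f (Icc (-1 : ℝ) 1) {q : ℝ × ℝ | dist q.1 q.2 < ε} (m * n) (s : Set ℝ)) :
    itineraryCount f c (m * n) ≤ s.card * 3 ^ n := by
  have hsub : itinerary f c (m * n) '' Icc (-1 : ℝ) 1 ⊆ ⋃ y ∈ s, itinerary f c (m * n) ''
      {x | x ∈ Icc (-1 : ℝ) 1 ∧ ∀ j < n, f^[m * j] x ∈ Metric.ball (f^[m * j] y) ε} := by
    rintro _ ⟨x, hx, rfl⟩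
    obtain ⟨y, hy, hxy⟩ := hs hx
    rw [mem_dynEntourage] at hxy
    refine mem_biUnion hy ⟨x, ⟨hx, fun j hj => ?_⟩, rfl⟩
    exact hxy (m * j) (by nlinarith)
  refine (ncard_le_ncard hsub (toFinite _)).trans ?_
  refine (Finset.set_ncard_biUnion_le _ _).trans ?_
  refine (Finset.sum_le_card_nsmul _ _ (3 ^ n) fun y _ => ?_).trans (by simp)
  exact hf.ncard_itinerary_blocks_le (fun j => hε _) n

end IsUnimodalMax

namespace IsUnimodalMax

variable {f : ℝ → ℝ} {c : ℝ}

open Dynamics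

theorem coverEntropy_le_of_forall {a : ℝ} {T : ℝ → ℝ} {F : Set ℝ}
    (h : ∀ ε > 0, ∀ b > a, ∀ᶠ n : ℕ in atTop, ∃ s : Finset ℝ,
      IsDynCoverOf T F {q : ℝ × ℝ | dist q.1 q.2 < ε} n (s : Set ℝ) ∧
        (s.card : ℝ) ≤ Real.exp (b * n)) : coverEntropy T F ≤ (a : EReal) := by
  refine iSup₂_le fun U hU => ?_
  obtain ⟨ε, hε, hεU⟩ := Metric.mem_uniformity_dist.1 hU
  refine EReal.le_of_forall_lt_iff_le.1 fun b hb => ?_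
  refine Eventually.expGrowthSup_le ?_
  have hb' : a < b := by exact_mod_cast hb
  filter_upwards [h ε hε b hb'] with n ⟨s, hs, hsc⟩
  have hs' : IsDynCoverOf T F U n (s : Set ℝ) :=
    hs.of_entourage_subset fun q hq => hεU hq
  have h1 : ((coverMincard T F U n : ℕ∞) : ENNReal) ≤ ((s.card : ℕ∞) : ENNReal) :=
    ENat.toENNReal_mono hs'.coverMincard_le_card
  refine h1.trans ?_
  have h2 : ((b : EReal) * (n : EReal)) = ((b * n : ℝ) : EReal) := by push_cast; rfl
  rw [h2, EReal.exp_coe]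
  rw [ENat.toENNReal_coe, ← ENNReal.ofReal_natCast]
  exact ENNReal.ofReal_le_ofReal hsc

theorem exists_card_le_exp_of_coverEntropy_lt {b : ℝ} {T : ℝ → ℝ} {F : Set ℝ} {ε : ℝ}
    (hε : 0 < ε) (h : coverEntropy T F < (b : EReal)) :
    ∀ᶠ n : ℕ in atTop, ∃ s : Finset ℝ,
      IsDynCoverOf T F {q : ℝ × ℝ | dist q.1 q.2 < ε} n (s : Set ℝ) ∧
        (s.card : ℝ) ≤ Real.exp (b * n) := by
  have h1 := (coverEntropyEntourage_le_coverEntropy T F (Metric.dist_mem_uniformity hε)).trans_lt h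
  filter_upwards [ExpGrowth.eventually_le_exp h1] with n hn
  have h2 : ((b : EReal) * (n : EReal)) = ((b * n : ℝ) : EReal) := by push_cast; rfl
  rw [h2, EReal.exp_coe] at hn
  have hlt : coverMincard T F {q : ℝ × ℝ | dist q.1 q.2 < ε} n < ⊤ := by
    rw [← ENat.toENNReal_lt, ENat.toENNReal_top]
    exact hn.trans_lt ENNReal.ofReal_lt_top
  obtain ⟨s, hs, hsc⟩ := (coverMincard_finite_iff _ _ _ _).1 hlt
  refine ⟨s, hs, ?_⟩
  rw [← hsc, ENat.toENNReal_coe, ← ENNReal.ofReal_natCast,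
    ENNReal.ofReal_le_ofReal_iff (Real.exp_pos _).le] at hn
  exact hn

theorem exists_itineraryCount_le (hf : IsUnimodalMax f c) {b : ℝ}
    (hb : coverEntropy f (Icc (-1 : ℝ) 1) < (b : EReal)) {δ : ℝ} (hδ : 0 < δ) :
    ∃ C : ℝ, ∀ n, (itineraryCount f c n : ℝ) ≤ C * Real.exp (n * (b + δ)) := by
  have hb0 : 0 < b := by
    have := (coverEntropy_nonneg f (F := Icc (-1 : ℝ) 1) ⟨0, by norm_num⟩).trans_lt hb
    exact_mod_cast this
  obtain ⟨m, hm⟩ := exists_nat_gt (Real.log 3 / δ)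
  have hl3 : 0 < Real.log 3 := Real.log_pos (by norm_num)
  have hm0 : (0 : ℝ) < m := lt_of_le_of_lt (by positivity) hm
  have hm1 : 1 ≤ m := by exact_mod_cast hm0
  rw [div_lt_iff₀ hδ] at hm
  obtain ⟨ε, hε, hball⟩ := hf.exists_ncard_itinerary_ball_le m
  obtain ⟨N, hN⟩ := eventually_atTop.1 (exists_card_le_exp_of_coverEntropy_lt hε hb)
  refine ⟨3 ^ (N + m), fun n => ?_⟩
  have hr : n % m < m := Nat.mod_lt _ hm1
  have hdm := Nat.div_add_mod n m
  set q := n / m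
  set r := n % m
  by_cases hq : N ≤ m * q
  · obtain ⟨s, hs, hsc⟩ := hN (m * q) hq
    have h1 := hf.itineraryCount_le_of_isDynCoverOf hball hm1 q s hs
    have h2 := hf.itineraryCount_add_le (m * q) r
    rw [hdm] at h2
    have h3 : itineraryCount f c r ≤ 3 ^ (N + m) :=
      (itineraryCount_le f c r).trans (Nat.pow_le_pow_right (by norm_num) (by omega))
    have h4 : (itineraryCount f c n : ℝ) ≤ (s.card * 3 ^ q) * 3 ^ (N + m) := by
      exact_mod_cast h2.trans (Nat.mul_le_mul h1 h3)
    refine h4.trans ?_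
    rw [mul_comm]
    refine mul_le_mul_of_nonneg_left ?_ (by positivity)
    have hqn : (m : ℝ) * q ≤ n := by exact_mod_cast (by omega : m * q ≤ n)
    have h5 : ((3 : ℝ) ^ q) ≤ Real.exp (n * δ) := by
      rw [← Real.exp_log (show (0 : ℝ) < 3 by norm_num), ← Real.exp_nat_mul]
      refine Real.exp_le_exp.2 ?_
      calc (q : ℝ) * Real.log 3 ≤ q * (m * δ) := by gcongr
        _ = (m * q) * δ := by ring
        _ ≤ n * δ := by gcongr
    calc (s.card : ℝ) * 3 ^ q ≤ Real.exp (b * (m * q : ℕ)) * Real.exp (n * δ) := by gcongr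
      _ ≤ Real.exp (b * n) * Real.exp (n * δ) := by
        gcongr; omega
      _ = Real.exp (n * (b + δ)) := by rw [← Real.exp_add]; ring_nf
  · have h1 : itineraryCount f c n ≤ 3 ^ (N + m) :=
      (itineraryCount_le f c n).trans (Nat.pow_le_pow_right (by norm_num) (by omega))
    have h2 : (1 : ℝ) ≤ Real.exp (n * (b + δ)) := Real.one_le_exp (by positivity)
    have h3 : (itineraryCount f c n : ℝ) ≤ 3 ^ (N + m) := by exact_mod_cast h1
    nlinarith [show (0 : ℝ) < 3 ^ (N + m) by positivity]

end IsUnimodalMax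

/-- The orientation of `f^[i]` on the set of points with itinerary `w`. -/
def orientation {n : ℕ} (w : Fin n → SignType) : ℕ → ℤ
  | 0 => 1
  | i + 1 => if h : i < n then
      (if w ⟨i, h⟩ = 1 then -orientation w i else orientation w i) else orientation w i

theorem orientation_eq {n : ℕ} (w : Fin n → SignType) (i : ℕ) :
    orientation w i = 1 ∨ orientation w i = -1 := by
  induction i with
  | zero => exact Or.inl rfl
  | succ i ih =>
    unfold orientation
    split_ifs <;> grind

namespace IsUnimodalMax

variable {f : ℝ → ℝ} {c : ℝ}

open Dynamics

theorem orientation_mul_iterate_le (hf : IsUnimodalMax f c) {n : ℕ} {x y : ℝ}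
    (hx : x ∈ Icc (-1 : ℝ) 1) (hy : y ∈ Icc (-1 : ℝ) 1) (hxy : x ≤ y)
    (hw : itinerary f c n x = itinerary f c n y) {i : ℕ} (hi : i ≤ n) :
    (orientation (itinerary f c n x) i : ℝ) * f^[i] x ≤
      (orientation (itinerary f c n x) i : ℝ) * f^[i] y := by
  induction i with
  | zero => simpa [orientation] using hxy
  | succ i ih =>
    have hi' : i < n := hi
    specialize ih hi'.le
    have hl : SignType.sign (f^[i] x - c) = SignType.sign (f^[i] y - c) := congrFun hw ⟨i, hi'⟩
    have hsx : itinerary f c n x ⟨i, hi'⟩ = SignType.sign (f^[i] x - c) := rfl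
    have hX := hf.mapsTo_iterate i hx
    have hY := hf.mapsTo_iterate i hy
    rw [orientation, dif_pos hi', Function.iterate_succ_apply', Function.iterate_succ_apply']
    have hor := orientation_eq (itinerary f c n x) i
    rw [hsx]
    clear hsx
    set X := f^[i] x
    set Y := f^[i] y
    by_cases h1 : SignType.sign (X - c) = 1
    · rw [if_pos h1]
      rw [h1] at hl
      have hXc : c < X := by simpa using sign_eq_one_iff.1 h1
      have hYc : c < Y := by simpa using sign_eq_one_iff.1 hl.symm
      rcases hor with h | h <;> rw [h] at ih ⊢ <;> push_cast at ih ⊢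
      · have := hf.anti.antitoneOn ⟨hXc.le, hX.2⟩ ⟨hYc.le, hY.2⟩ (by linarith)
        linarith
      · have := hf.anti.antitoneOn ⟨hYc.le, hY.2⟩ ⟨hXc.le, hX.2⟩ (by linarith)
        linarith
    · rw [if_neg h1]
      have h2 : ¬ SignType.sign (Y - c) = 1 := hl ▸ h1
      have hXc : X ≤ c := by
        by_contra hcon; push Not at hcon
        exact h1 (sign_pos (by linarith))
      have hYc : Y ≤ c := by
        by_contra hcon; push Not at hcon
        exact h2 (sign_pos (by linarith))
      rcases hor with h | h <;> rw [h] at ih ⊢ <;> push_cast at ih ⊢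
      · have := hf.mono.monotoneOn ⟨hX.1, hXc⟩ ⟨hY.1, hYc⟩ (by linarith)
        linarith
      · have := hf.mono.monotoneOn ⟨hY.1, hYc⟩ ⟨hX.1, hXc⟩ (by linarith)
        linarith

/-- A monotone integer potential recording the `ε`-cells visited before time `n`. -/
noncomputable def cellPotential (f : ℝ → ℝ) (c ε : ℝ) (n : ℕ) (x : ℝ) : ℤ :=
  ∑ i ∈ Finset.range n, orientation (itinerary f c n x) i * ⌊f^[i] x / ε⌋

theorem dist_iterate_lt_of_cellPotential_eq (hf : IsUnimodalMax f c) {n : ℕ} {ε x y : ℝ}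
    (hε : 0 < ε)
    (hx : x ∈ Icc (-1 : ℝ) 1) (hy : y ∈ Icc (-1 : ℝ) 1) (hxy : x ≤ y)
    (hw : itinerary f c n x = itinerary f c n y)
    (hp : cellPotential f c ε n x = cellPotential f c ε n y) {i : ℕ} (hi : i < n) :
    dist (f^[i] x) (f^[i] y) < ε := by
  unfold cellPotential at hp
  rw [← hw] at hp
  have hle : ∀ i ∈ Finset.range n, orientation (itinerary f c n x) i * ⌊f^[i] x / ε⌋ ≤
      orientation (itinerary f c n x) i * ⌊f^[i] y / ε⌋ := by
    intro i hi
    have h := hf.orientation_mul_iterate_le hx hy hxy hw (Finset.mem_range.1 hi).le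
    rcases orientation_eq (itinerary f c n x) i with ho | ho <;> rw [ho] at h ⊢ <;>
      push_cast at h
    · have : ⌊f^[i] x / ε⌋ ≤ ⌊f^[i] y / ε⌋ := by gcongr; linarith
      linarith
    · have : ⌊f^[i] y / ε⌋ ≤ ⌊f^[i] x / ε⌋ := by gcongr; linarith
      linarith
  have heq := (Finset.sum_eq_sum_iff_of_le hle).1 hp i (Finset.mem_range.2 hi)
  have hfl : ⌊f^[i] x / ε⌋ = ⌊f^[i] y / ε⌋ := by
    rcases orientation_eq (itinerary f c n x) i with ho | ho <;> rw [ho] at heq <;> linarith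
  have := Int.abs_sub_lt_one_of_floor_eq_floor hfl
  rwa [← sub_div, abs_div, abs_of_pos hε, div_lt_one hε] at this

theorem abs_cellPotential_le (hf : IsUnimodalMax f c) {n : ℕ} {ε x : ℝ} (hε : 0 < ε)
    (hx : x ∈ Icc (-1 : ℝ) 1) : |cellPotential f c ε n x| ≤ n * (⌈1 / ε⌉ + 1) := by
  refine (Finset.abs_sum_le_sum_abs _ _).trans ?_
  refine (Finset.sum_le_card_nsmul _ _ (⌈1 / ε⌉ + 1) fun i _ => ?_).trans (by simp)
  have h1 : |orientation (itinerary f c n x) i| = 1 := by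
    rcases orientation_eq (itinerary f c n x) i with h | h <;> simp [h]
  rw [abs_mul, h1, one_mul]
  have hX := hf.mapsTo_iterate i hx
  have h2 : f^[i] x / ε ≤ 1 / ε := by gcongr; exact hX.2
  have h3 : -(1 / ε) ≤ f^[i] x / ε := by rw [← neg_div]; gcongr; exact hX.1
  have h4 := Int.le_ceil (1 / ε)
  rw [abs_le]
  constructor
  · rw [Int.le_floor]; push_cast; linarith
  · have : ((⌊f^[i] x / ε⌋ : ℤ) : ℝ) ≤ ⌈1 / ε⌉ := (Int.floor_le _).trans (h2.trans h4)
    have : ⌊f^[i] x / ε⌋ ≤ ⌈1 / ε⌉ := by exact_mod_cast this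
    linarith

theorem exists_isDynCoverOf (hf : IsUnimodalMax f c) {ε : ℝ} (hε : 0 < ε) (n : ℕ) :
    ∃ s : Finset ℝ, IsDynCoverOf f (Icc (-1 : ℝ) 1) {q : ℝ × ℝ | dist q.1 q.2 < ε} n (s : Set ℝ) ∧
      s.card ≤ itineraryCount f c n * (2 * (n * (⌈1 / ε⌉.toNat + 1)) + 1) := by
  set M : ℤ := n * (⌈1 / ε⌉ + 1) with hM
  have hc0 : 0 ≤ ⌈1 / ε⌉ := Int.ceil_nonneg (by positivity)
  set code : ℝ → (Fin n → SignType) × ℤ := fun x => (itinerary f c n x, cellPotential f c ε n x)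
  have hcode : code '' Icc (-1 : ℝ) 1 ⊆ (itinerary f c n '' Icc (-1 : ℝ) 1) ×ˢ Icc (-M) M := by
    rintro _ ⟨x, hx, rfl⟩
    exact ⟨⟨x, hx, rfl⟩, abs_le.1 (hf.abs_cellPotential_le hε hx)⟩
  have hfin : ((itinerary f c n '' Icc (-1 : ℝ) 1) ×ˢ Icc (-M) M).Finite :=
    (toFinite _).prod (finite_Icc _ _)
  obtain ⟨S, hSI, hS⟩ := (surjOn_image code (Icc (-1 : ℝ) 1)).exists_bijOn_subset
  have hSfin : S.Finite := by
    refine Finite.of_finite_image ?_ hS.injOn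
    rw [hS.image_eq]
    exact hfin.subset hcode
  refine ⟨hSfin.toFinset, ?_, ?_⟩
  · intro x hx
    obtain ⟨y, hy, hxy⟩ := hS.surjOn ⟨x, hx, rfl⟩
    refine ⟨y, by simpa using hy, ?_⟩
    rw [mem_dynEntourage]
    intro i hi
    simp only [code, Prod.mk.injEq] at hxy
    rcases le_total x y with h | h
    · exact hf.dist_iterate_lt_of_cellPotential_eq hε hx (hSI hy) h hxy.1.symm hxy.2.symm hi
    · have := hf.dist_iterate_lt_of_cellPotential_eq hε (hSI hy) hx h hxy.1 hxy.2 hi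
      rw [dist_comm] at this
      exact this
  · rw [← ncard_eq_toFinset_card S hSfin, ← hS.injOn.ncard_image, hS.image_eq]
    refine (ncard_le_ncard hcode hfin).trans ?_
    rw [ncard_prod]
    refine Nat.mul_le_mul le_rfl ?_
    rw [← Finset.coe_Icc, ncard_coe_finset, Int.card_Icc, hM]
    have hn0 : (0 : ℤ) ≤ n * (⌈1 / ε⌉ + 1) := by positivity
    zify
    rw [Int.toNat_of_nonneg (by linarith), Int.toNat_of_nonneg hc0]
    linarith

theorem coverEntropy_le (hf : IsUnimodalMax f c) {m : ℕ} (hm : m ≠ 0) :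
    coverEntropy f (Icc (-1 : ℝ) 1) ≤ ((Real.log (itineraryCount f c m) / m : ℝ) : EReal) := by
  refine coverEntropy_le_of_forall fun ε hε b hb => ?_
  set A : ℝ := (itineraryCount f c m : ℝ) with hA
  have hA1 : 1 ≤ A := Nat.one_le_cast.2 (itineraryCount_pos f c m)
  set a := Real.log A / m with ha
  have hm' : (0 : ℝ) < m := by positivity
  have hlA : Real.log A = a * m := by rw [ha]; field_simp
  have ha0 : 0 ≤ a := by rw [ha]; have := Real.log_nonneg hA1; positivity
  set M : ℝ := ((⌈1 / ε⌉.toNat + 1 : ℕ) : ℝ) with hMdef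
  have hlim : Tendsto (fun n : ℕ => (A * 3 ^ m * (2 * M * n + 1)) * Real.exp (-((b - a) * n))) atTop
      (nhds 0) := by
    have h0 : 0 < b - a := by linarith
    have h1 : Tendsto (fun n : ℕ => (b - a) * (n : ℝ)) atTop atTop :=
      Tendsto.const_mul_atTop h0 tendsto_natCast_atTop_atTop
    have h2 := (Real.tendsto_pow_mul_exp_neg_atTop_nhds_zero 1).comp h1
    have h3 := (Real.tendsto_pow_mul_exp_neg_atTop_nhds_zero 0).comp h1
    have h4 := (h2.const_mul (A * 3 ^ m * (2 * M) / (b - a))).add (h3.const_mul (A * 3 ^ m))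
    simp only [mul_zero, add_zero] at h4
    refine h4.congr fun n => ?_
    simp only [Function.comp, pow_one, pow_zero]
    field_simp
  filter_upwards [hlim.eventually (Iic_mem_nhds (show (0 : ℝ) < 1 by norm_num))] with n hn
  obtain ⟨s, hs, hsc⟩ := hf.exists_isDynCoverOf hε n
  refine ⟨s, hs, ?_⟩
  have hr : n % m < m := Nat.mod_lt _ (by omega)
  have hdm := Nat.div_add_mod n m
  set q := n / m
  set r := n % m
  have h1 : itineraryCount f c n ≤ itineraryCount f c m ^ q * 3 ^ m := by
    have := hf.itineraryCount_add_le (m * q) r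
    rw [hdm] at this
    refine this.trans (Nat.mul_le_mul (hf.itineraryCount_mul_le m q) ?_)
    exact (itineraryCount_le f c r).trans (Nat.pow_le_pow_right (by norm_num) hr.le)
  have h2 : A ^ q ≤ Real.exp (a * n) := by
    rw [← Real.exp_log (by linarith : 0 < A), ← Real.exp_nat_mul, hlA]
    refine Real.exp_le_exp.2 ?_
    have : (m : ℝ) * q ≤ n := by exact_mod_cast (by omega : m * q ≤ n)
    nlinarith
  have h3 : (itineraryCount f c n : ℝ) ≤ A ^ q * 3 ^ m := by
    rw [hA]
    exact_mod_cast h1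
  have h4 : (s.card : ℝ) ≤ itineraryCount f c n * (2 * (n * M) + 1) := by
    rw [hMdef]
    exact_mod_cast hsc
  have hM0 : 0 ≤ M := by positivity
  replace hn : A * 3 ^ m * (2 * M * n + 1) * Real.exp (-((b - a) * n)) ≤ 1 := hn
  have h5 : A * 3 ^ m * (2 * M * n + 1) ≤ Real.exp ((b - a) * n) := by
    rw [Real.exp_neg] at hn
    rwa [← div_eq_mul_inv, div_le_one (Real.exp_pos _)] at hn
  calc (s.card : ℝ) ≤ (A ^ q * 3 ^ m) * (2 * (n * M) + 1) := h4.trans (by gcongr)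
    _ ≤ (Real.exp (a * n) * (A * 3 ^ m)) * (2 * (n * M) + 1) := by
      gcongr
      exact le_mul_of_one_le_left (by positivity) hA1
    _ = Real.exp (a * n) * (A * 3 ^ m * (2 * M * n + 1)) := by ring
    _ ≤ Real.exp (a * n) * Real.exp ((b - a) * n) := by gcongr
    _ = Real.exp (b * n) := by rw [← Real.exp_add]; ring_nf

theorem coe_entropyOn (hf : IsUnimodalMax f c) :
    ((entropyOn f (Icc (-1 : ℝ) 1) : ℝ) : EReal) = coverEntropy f (Icc (-1 : ℝ) 1) := by
  refine EReal.coe_toReal ?_ ?_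
  · exact ((hf.coverEntropy_le one_ne_zero).trans_lt (EReal.coe_lt_top _)).ne
  · have := coverEntropy_nonneg f (F := Icc (-1 : ℝ) 1) ⟨0, by norm_num⟩
    exact (lt_of_lt_of_le (EReal.bot_lt_coe 0) this).ne'

theorem entropyOn_nonneg (hf : IsUnimodalMax f c) : 0 ≤ entropyOn f (Icc (-1 : ℝ) 1) := by
  have := coverEntropy_nonneg f (F := Icc (-1 : ℝ) 1) ⟨0, by norm_num⟩
  rw [← hf.coe_entropyOn] at this
  exact_mod_cast this

theorem exp_mul_entropyOn_le (hf : IsUnimodalMax f c) (n : ℕ) :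
    Real.exp (n * entropyOn f (Icc (-1 : ℝ) 1)) ≤ itineraryCount f c n := by
  have hA : (0 : ℝ) < itineraryCount f c n := by exact_mod_cast itineraryCount_pos f c n
  rcases eq_or_ne n 0 with rfl | hn
  · rw [Nat.cast_zero, zero_mul, Real.exp_zero]
    exact_mod_cast itineraryCount_pos f c 0
  have := hf.coverEntropy_le hn
  rw [← hf.coe_entropyOn, EReal.coe_le_coe_iff, le_div_iff₀ (by positivity)] at this
  rw [← Real.le_log_iff_exp_le hA]
  linarith

theorem exists_itineraryCount_le_exp (hf : IsUnimodalMax f c) {δ : ℝ} (hδ : 0 < δ) :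
    ∃ C : ℝ, ∀ n, (itineraryCount f c n : ℝ) ≤
      C * Real.exp (n * (entropyOn f (Icc (-1 : ℝ) 1) + δ)) := by
  have : coverEntropy f (Icc (-1 : ℝ) 1) <
      ((entropyOn f (Icc (-1 : ℝ) 1) + δ / 2 : ℝ) : EReal) := by
    rw [← hf.coe_entropyOn, EReal.coe_lt_coe_iff]
    linarith
  obtain ⟨C, hC⟩ := hf.exists_itineraryCount_le this (half_pos hδ)
  refine ⟨C, fun n => (hC n).trans_eq ?_⟩
  ring_nf

end IsUnimodalMax

/-- The kneading signs of a unimodal map: the orientation of `f^[n]` near the critical value,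
reset whenever the critical point is periodic. -/
noncomputable def kneadingSign (f : ℝ → ℝ) (c : ℝ) : ℕ → ℝ
  | 0 => 1
  | n + 1 => if f^[n + 1] c = c then 1 else
      if f^[n + 1] c < c then kneadingSign f c n else -kneadingSign f c n

theorem kneadingSign_eq (f : ℝ → ℝ) (c : ℝ) (n : ℕ) :
    kneadingSign f c n = 1 ∨ kneadingSign f c n = -1 := by
  induction n with
  | zero => exact Or.inl rfl
  | succ n ih =>
    rw [kneadingSign]
    split_ifs <;> grind

/-- The points whose orbit hits the turning point for the first time at time `j`. -/
def firstHit (f : ℝ → ℝ) (c : ℝ) (j : ℕ) : Set ℝ :=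
  {x | x ∈ Icc (-1 : ℝ) 1 ∧ f^[j] x = c ∧ ∀ i < j, f^[i] x ≠ c}

/-- The number of first hits at time `j` below the critical value. -/
noncomputable def hitCount (f : ℝ → ℝ) (c : ℝ) (j : ℕ) : ℕ :=
  (firstHit f c j ∩ Iio (f c)).ncard

open Classical in
/-- The number of first hits at time `j` below the `n`-th point of the critical orbit. -/
noncomputable def hitCountBelow (f : ℝ → ℝ) (c : ℝ) (n j : ℕ) : ℕ :=
  if kneadingSign f c n = 1 then (firstHit f c j ∩ Iio (f^[n + 1] c)).ncard
  else (firstHit f c j ∩ Iic (f^[n + 1] c)).ncard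

namespace IsUnimodalMax

variable {f : ℝ → ℝ} {c : ℝ}

theorem finite_firstHit (hf : IsUnimodalMax f c) (j : ℕ) : (firstHit f c j).Finite :=
  (hf.finite_iterate_eq j).subset fun _ hx => ⟨hx.1, hx.2.1⟩

theorem firstHit_zero (hf : IsUnimodalMax f c) : firstHit f c 0 = {c} := by
  ext x
  simp only [firstHit, mem_ofPred_eq, Function.iterate_zero, id, mem_singleton_iff]
  constructor
  · exact fun h => h.2.1
  · rintro rfl
    exact ⟨hf.mem_Icc, rfl, by simp⟩

theorem mem_firstHit_succ (hf : IsUnimodalMax f c) {j : ℕ} {x : ℝ} (hx : x ∈ Icc (-1 : ℝ) 1) :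
    x ∈ firstHit f c (j + 1) ↔ x ≠ c ∧ f x ∈ firstHit f c j := by
  simp only [firstHit, mem_ofPred_eq, hx, hf.mapsTo hx, true_and, Function.iterate_succ_apply]
  constructor
  · rintro ⟨h1, h2⟩
    refine ⟨h2 0 (by omega), h1, fun i hi => ?_⟩
    exact h2 (i + 1) (by omega)
  · rintro ⟨h0, h1, h2⟩
    refine ⟨h1, fun i hi => ?_⟩
    rcases i with _ | i
    · exact h0
    · exact h2 i (by omega)

theorem le_critVal (hf : IsUnimodalMax f c) {x : ℝ} (hx : x ∈ Icc (-1 : ℝ) 1) : f x ≤ f c := by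
  rcases le_total x c with h | h
  · exact hf.mono.monotoneOn ⟨hx.1, h⟩ ⟨hf.mem_Icc.1, le_rfl⟩ h
  · exact hf.anti.antitoneOn ⟨le_rfl, hf.mem_Icc.2⟩ ⟨h, hx.2⟩ h

theorem lt_critVal (hf : IsUnimodalMax f c) {x : ℝ} (hx : x ∈ Icc (-1 : ℝ) 1) (hne : x ≠ c) :
    f x < f c := by
  rcases lt_or_gt_of_ne hne with h | h
  · exact hf.mono ⟨hx.1, h.le⟩ ⟨hf.mem_Icc.1, le_rfl⟩ h
  · exact hf.anti ⟨le_rfl, hf.mem_Icc.2⟩ ⟨h.le, hx.2⟩ h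

theorem ncard_firstHit_left (hf : IsUnimodalMax f c) (j : ℕ) {P P' : ℝ → Prop}
    (h : ∀ x ∈ Ico (-1) c, P x ↔ P' (f x)) :
    {x | x ∈ firstHit f c (j + 1) ∧ x < c ∧ P x}.ncard =
      {z | z ∈ firstHit f c j ∧ z < f c ∧ P' z}.ncard := by
  refine ncard_congr (fun x _ => f x) ?_ ?_ ?_
  · rintro x ⟨hx, hxc, hP⟩
    have hI := hx.1
    exact ⟨((hf.mem_firstHit_succ hI).1 hx).2, hf.lt_critVal hI hxc.ne, (h x ⟨hI.1, hxc⟩).1 hP⟩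
  · rintro x y ⟨hx, hxc, -⟩ ⟨hy, hyc, -⟩ hxy
    exact hf.mono.injOn ⟨hx.1.1, hxc.le⟩ ⟨hy.1.1, hyc.le⟩ hxy
  · rintro z ⟨hz, hzc, hP⟩
    have hcont : ContinuousOn f (Icc (-1) c) :=
      hf.cont.mono (Icc_subset_Icc le_rfl hf.mem_Icc.2)
    obtain ⟨x, hx, rfl⟩ := intermediate_value_Icc hf.mem_Icc.1 hcont
      (show z ∈ Icc (f (-1)) (f c) by rw [hf.left]; exact ⟨hz.1.1, hzc.le⟩)
    have hxc : x < c := lt_of_le_of_ne hx.2 (by rintro rfl; exact hzc.ne rfl)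
    exact ⟨x, ⟨(hf.mem_firstHit_succ ⟨hx.1, hx.2.trans hf.mem_Icc.2⟩).2 ⟨hxc.ne, hz⟩, hxc,
      (h x ⟨hx.1, hxc⟩).2 hP⟩, rfl⟩

theorem ncard_firstHit_right (hf : IsUnimodalMax f c) (j : ℕ) {P P' : ℝ → Prop}
    (h : ∀ x ∈ Ioc c 1, P x ↔ P' (f x)) :
    {x | x ∈ firstHit f c (j + 1) ∧ c < x ∧ P x}.ncard =
      {z | z ∈ firstHit f c j ∧ z < f c ∧ P' z}.ncard := by
  refine ncard_congr (fun x _ => f x) ?_ ?_ ?_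
  · rintro x ⟨hx, hxc, hP⟩
    have hI := hx.1
    exact ⟨((hf.mem_firstHit_succ hI).1 hx).2, hf.lt_critVal hI hxc.ne', (h x ⟨hxc, hI.2⟩).1 hP⟩
  · rintro x y ⟨hx, hxc, -⟩ ⟨hy, hyc, -⟩ hxy
    exact hf.anti.injOn ⟨hxc.le, hx.1.2⟩ ⟨hyc.le, hy.1.2⟩ hxy
  · rintro z ⟨hz, hzc, hP⟩
    have hcont : ContinuousOn f (Icc c 1) :=
      hf.cont.mono (Icc_subset_Icc hf.mem_Icc.1 le_rfl)
    obtain ⟨x, hx, rfl⟩ := intermediate_value_Icc' hf.mem_Icc.2 hcont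
      (show z ∈ Icc (f 1) (f c) by rw [hf.right]; exact ⟨hz.1.1, hzc.le⟩)
    have hxc : c < x := lt_of_le_of_ne hx.1 (by rintro rfl; exact hzc.ne rfl)
    exact ⟨x, ⟨(hf.mem_firstHit_succ ⟨hf.mem_Icc.1.trans hx.1, hx.2⟩).2 ⟨hxc.ne', hz⟩, hxc,
      (h x ⟨hxc, hx.2⟩).2 hP⟩, rfl⟩

theorem ncard_firstHit_split (hf : IsUnimodalMax f c) (j : ℕ) (P : ℝ → Prop) :
    {x | x ∈ firstHit f c (j + 1) ∧ P x}.ncard =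
      {x | x ∈ firstHit f c (j + 1) ∧ x < c ∧ P x}.ncard +
        {x | x ∈ firstHit f c (j + 1) ∧ c < x ∧ P x}.ncard := by
  rw [← ncard_union_eq ?_ ((hf.finite_firstHit _).subset fun x hx => hx.1)
    ((hf.finite_firstHit _).subset fun x hx => hx.1)]
  · congr 1
    ext x
    simp only [mem_ofPred_eq, mem_union]
    constructor
    · rintro ⟨h1, h2⟩
      rcases lt_or_gt_of_ne ((hf.mem_firstHit_succ h1.1).1 h1).1 with h | h
      · exact Or.inl ⟨h1, h, h2⟩
      · exact Or.inr ⟨h1, h, h2⟩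
    · rintro (h | h) <;> exact ⟨h.1, h.2.2⟩
  · rw [disjoint_left]
    rintro x h1 h2
    exact lt_asymm h1.2.1 h2.2.1

theorem ncard_firstHit_compl (hf : IsUnimodalMax f c) (j : ℕ) (P : ℝ → Prop) :
    {x | x ∈ firstHit f c j ∧ x < f c ∧ P x}.ncard +
      {x | x ∈ firstHit f c j ∧ x < f c ∧ ¬ P x}.ncard = hitCount f c j := by
  rw [hitCount, ← ncard_union_eq ?_ ((hf.finite_firstHit _).subset fun x hx => hx.1)
    ((hf.finite_firstHit _).subset fun x hx => hx.1)]
  · congr 1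
    ext x
    simp only [mem_ofPred_eq, mem_union, mem_inter_iff, mem_Iio]
    tauto
  · rw [disjoint_left]
    rintro x h1 h2
    exact h2.2.2 h1.2.2

theorem ncard_firstHit_succ (hf : IsUnimodalMax f c) (j : ℕ) :
    (firstHit f c (j + 1)).ncard = 2 * hitCount f c j := by
  have h1 := hf.ncard_firstHit_split j (fun _ => True)
  rw [hf.ncard_firstHit_left j (P := fun _ => True) (P' := fun _ => True) (by simp),
    hf.ncard_firstHit_right j (P := fun _ => True) (P' := fun _ => True) (by simp)] at h1
  simp only [and_true, ofPred_mem_eq] at h1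
  rw [h1, two_mul]
  rfl

theorem hitCountBelow_zero_left (f : ℝ → ℝ) (c : ℝ) (j : ℕ) :
    hitCountBelow f c 0 j = hitCount f c j := by
  simp [hitCountBelow, hitCount, kneadingSign]

theorem hitCountBelow_zero_right (hf : IsUnimodalMax f c) (n : ℕ) :
    (hitCountBelow f c n 0 : ℝ) = (1 - kneadingSign f c n * kneadingSign f c (n + 1)) / 2 := by
  rw [hitCountBelow, hf.firstHit_zero, kneadingSign]
  have h1 : ∀ S : Set ℝ, c ∈ S → (({c} : Set ℝ) ∩ S).ncard = 1 := fun S h => by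
    rw [singleton_inter_of_mem h, ncard_singleton]
  have h0 : ∀ S : Set ℝ, c ∉ S → (({c} : Set ℝ) ∩ S).ncard = 0 := fun S h => by
    rw [singleton_inter_eq_empty.2 h, ncard_empty]
  have hn : ¬ ((-1 : ℝ) = 1) := by norm_num
  rcases lt_trichotomy (f^[n + 1] c) c with h | h | h <;>
    rcases kneadingSign_eq f c n with ht | ht <;> rw [ht]
  · rw [if_pos rfl, if_neg h.ne, if_pos h, h0 _ (by simpa using h.le)]; norm_num
  · rw [if_neg hn, if_neg h.ne, if_pos h, h0 _ (by simpa using h)]; norm_num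
  · rw [if_pos rfl, if_pos h, h0 _ (by simp [h])]; norm_num
  · rw [if_neg hn, if_pos h, h1 _ (by simp [h])]; norm_num
  · rw [if_pos rfl, if_neg h.ne', if_neg h.not_gt, h1 _ (by simpa using h)]; norm_num
  · rw [if_neg hn, if_neg h.ne', if_neg h.not_gt, h1 _ (by simpa using h.le)]; norm_num

theorem iterate_mem (hf : IsUnimodalMax f c) (n : ℕ) : f^[n] c ∈ Icc (-1 : ℝ) 1 :=
  hf.mapsTo_iterate n hf.mem_Icc

theorem ncard_inter_Iio_of_lt (hf : IsUnimodalMax f c) (j : ℕ) {y : ℝ} (hy : y ∈ Icc (-1 : ℝ) 1)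
    (hyc : y ≤ c) :
    (firstHit f c (j + 1) ∩ Iio y).ncard = (firstHit f c j ∩ Iio (f y)).ncard := by
  have h := hf.ncard_firstHit_left j (P := fun x => x < y) (P' := fun z => z < f y)
    fun x hx => (hf.mono.lt_iff_lt ⟨hx.1, hx.2.le⟩ ⟨hy.1, hyc⟩).symm
  convert h using 2
  · ext x
    simp only [mem_inter_iff, mem_Iio, mem_ofPred_eq]
    exact ⟨fun h => ⟨h.1, h.2.trans_le hyc, h.2⟩, fun h => ⟨h.1, h.2.2⟩⟩
  · ext x
    simp only [mem_inter_iff, mem_Iio, mem_ofPred_eq]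
    exact ⟨fun h => ⟨h.1, h.2.trans_le (hf.le_critVal hy), h.2⟩, fun h => ⟨h.1, h.2.2⟩⟩

theorem ncard_inter_Iic_of_lt (hf : IsUnimodalMax f c) (j : ℕ) {y : ℝ} (hy : y ∈ Icc (-1 : ℝ) 1)
    (hyc : y < c) :
    (firstHit f c (j + 1) ∩ Iic y).ncard = (firstHit f c j ∩ Iic (f y)).ncard := by
  have h := hf.ncard_firstHit_left j (P := fun x => x ≤ y) (P' := fun z => z ≤ f y)
    fun x hx => (hf.mono.le_iff_le ⟨hx.1, hx.2.le⟩ ⟨hy.1, hyc.le⟩).symm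
  convert h using 2
  · ext x
    simp only [mem_inter_iff, mem_Iic, mem_ofPred_eq]
    exact ⟨fun h => ⟨h.1, h.2.trans_lt hyc, h.2⟩, fun h => ⟨h.1, h.2.2⟩⟩
  · ext x
    simp only [mem_inter_iff, mem_Iic, mem_ofPred_eq]
    exact ⟨fun h => ⟨h.1, h.2.trans_lt (hf.lt_critVal hy hyc.ne), h.2⟩, fun h => ⟨h.1, h.2.2⟩⟩

theorem ncard_inter_Iio_of_gt (hf : IsUnimodalMax f c) (j : ℕ) {y : ℝ} (hy : y ∈ Icc (-1 : ℝ) 1)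
    (hyc : c < y) :
    (firstHit f c (j + 1) ∩ Iio y).ncard + (firstHit f c j ∩ Iic (f y)).ncard =
      2 * hitCount f c j := by
  have h0 := hf.ncard_firstHit_split j (fun x => x < y)
  have h1 := hf.ncard_firstHit_left j (P := fun x => x < y) (P' := fun _ => True)
    fun x hx => by simpa using hx.2.trans hyc
  have h2 := hf.ncard_firstHit_right j (P := fun x => x < y) (P' := fun z => ¬ (z ≤ f y))
    fun x hx => by rw [not_le]; exact (hf.anti.lt_iff_gt ⟨hyc.le, hy.2⟩ ⟨hx.1.le, hx.2⟩).symm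
  have h3 := hf.ncard_firstHit_compl j (fun z => z ≤ f y)
  have h4 : {x | x ∈ firstHit f c j ∧ x < f c ∧ x ≤ f y} = firstHit f c j ∩ Iic (f y) := by
    ext x
    simp only [mem_inter_iff, mem_Iic, mem_ofPred_eq]
    exact ⟨fun h => ⟨h.1, h.2.2⟩, fun h => ⟨h.1, h.2.trans_lt (hf.lt_critVal hy hyc.ne'), h.2⟩⟩
  have h5 : {x | x ∈ firstHit f c (j + 1) ∧ x < y} = firstHit f c (j + 1) ∩ Iio y := rfl
  have h6 : {z | z ∈ firstHit f c j ∧ z < f c ∧ True}.ncard = hitCount f c j := by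
    simp only [and_true]; rfl
  rw [h4] at h3
  rw [h5] at h0
  omega

theorem ncard_inter_Iic_of_gt (hf : IsUnimodalMax f c) (j : ℕ) {y : ℝ} (hy : y ∈ Icc (-1 : ℝ) 1)
    (hyc : c < y) :
    (firstHit f c (j + 1) ∩ Iic y).ncard + (firstHit f c j ∩ Iio (f y)).ncard =
      2 * hitCount f c j := by
  have h0 := hf.ncard_firstHit_split j (fun x => x ≤ y)
  have h1 := hf.ncard_firstHit_left j (P := fun x => x ≤ y) (P' := fun _ => True)
    fun x hx => by simpa using (hx.2.trans hyc).le
  have h2 := hf.ncard_firstHit_right j (P := fun x => x ≤ y) (P' := fun z => ¬ (z < f y))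
    fun x hx => by rw [not_lt]; exact (hf.anti.le_iff_ge ⟨hyc.le, hy.2⟩ ⟨hx.1.le, hx.2⟩).symm
  have h3 := hf.ncard_firstHit_compl j (fun z => z < f y)
  have h4 : {x | x ∈ firstHit f c j ∧ x < f c ∧ x < f y} = firstHit f c j ∩ Iio (f y) := by
    ext x
    simp only [mem_inter_iff, mem_Iio, mem_ofPred_eq]
    exact ⟨fun h => ⟨h.1, h.2.2⟩, fun h => ⟨h.1, h.2.trans (hf.lt_critVal hy hyc.ne'), h.2⟩⟩
  have h5 : {x | x ∈ firstHit f c (j + 1) ∧ x ≤ y} = firstHit f c (j + 1) ∩ Iic y := rfl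
  have h6 : {z | z ∈ firstHit f c j ∧ z < f c ∧ True}.ncard = hitCount f c j := by
    simp only [and_true]; rfl
  rw [h4] at h3
  rw [h5] at h0
  omega

theorem hitCountBelow_succ (hf : IsUnimodalMax f c) (n j : ℕ) :
    (hitCountBelow f c n (j + 1) : ℝ) =
      kneadingSign f c n * kneadingSign f c (n + 1) * hitCountBelow f c (n + 1) j +
        (1 - kneadingSign f c n * kneadingSign f c (n + 1)) * hitCount f c j := by
  have hn : ¬ ((-1 : ℝ) = 1) := by norm_num
  have hy := hf.iterate_mem (n + 1)
  have hs : f^[n + 1 + 1] c = f (f^[n + 1] c) := Function.iterate_succ_apply' _ _ _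
  rw [hitCountBelow, hitCountBelow, hs]
  rcases lt_trichotomy (f^[n + 1] c) c with h | h | h
  · have hk : kneadingSign f c (n + 1) = kneadingSign f c n := by
      rw [kneadingSign, if_neg h.ne, if_pos h]
    rw [hk, hf.ncard_inter_Iio_of_lt j hy h.le, hf.ncard_inter_Iic_of_lt j hy h]
    rcases kneadingSign_eq f c n with ht | ht <;> rw [ht] <;> simp
  · have hk : kneadingSign f c (n + 1) = 1 := by
      rw [kneadingSign, if_pos h]
    have h1 := hf.ncard_inter_Iio_of_lt j hf.mem_Icc le_rfl
    have h2 : firstHit f c (j + 1) ∩ Iic c = firstHit f c (j + 1) ∩ Iio c := by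
      ext x
      simp only [mem_inter_iff, mem_Iic, mem_Iio, and_congr_right_iff]
      intro hx
      exact ⟨fun h => lt_of_le_of_ne h ((hf.mem_firstHit_succ hx.1).1 hx).1, le_of_lt⟩
    rw [hk, h, h2, h1, if_pos rfl, hitCount]
    rcases kneadingSign_eq f c n with ht | ht <;> rw [ht] <;> simp
    ring
  · have hk : kneadingSign f c (n + 1) = -kneadingSign f c n := by
      rw [kneadingSign, if_neg h.ne', if_neg h.not_gt]
    have h1 := congrArg (Nat.cast (R := ℝ)) (hf.ncard_inter_Iio_of_gt j hy h)
    have h2 := congrArg (Nat.cast (R := ℝ)) (hf.ncard_inter_Iic_of_gt j hy h)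
    push_cast at h1 h2
    rw [hk]
    rcases kneadingSign_eq f c n with ht | ht <;> rw [ht]
    · rw [if_pos rfl, if_neg hn]; linarith
    · rw [if_neg hn, if_pos (by norm_num)]; linarith

theorem hitCountBelow_le (hf : IsUnimodalMax f c) (n j : ℕ) :
    hitCountBelow f c n j ≤ hitCount f c j := by
  have hs : f^[n + 1] c = f (f^[n] c) := Function.iterate_succ_apply' _ _ _
  have hle := hf.le_critVal (hf.iterate_mem n)
  rw [hitCountBelow, hs]
  split_ifs with h
  · exact ncard_le_ncard (inter_subset_inter_right _ (Iio_subset_Iio hle))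
      ((hf.finite_firstHit j).inter_of_left _)
  · have hne : f^[n] c ≠ c := by
      intro hcon
      rcases n with _ | n
      · exact h rfl
      · exact h (by rw [kneadingSign, if_pos hcon])
    exact ncard_le_ncard (inter_subset_inter_right _
      (Iic_subset_Iio.2 (hf.lt_critVal (hf.iterate_mem n) hne)))
      ((hf.finite_firstHit j).inter_of_left _)

theorem ncard_firstHit_le (hf : IsUnimodalMax f c) (j : ℕ) :
    (firstHit f c j).ncard ≤ itineraryCount f c j := by
  refine ncard_le_ncard_of_injOn (itinerary f c j) (fun x hx => ⟨x, hx.1, rfl⟩) ?_ (toFinite _)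
  intro x hx y hy hxy
  by_contra hne
  have key : ∀ i ≤ j, f^[i] x ≠ f^[i] y := by
    intro i hi
    induction i with
    | zero => exact hne
    | succ i ih =>
      have hl : SignType.sign (f^[i] x - c) = SignType.sign (f^[i] y - c) :=
        congrFun hxy ⟨i, hi⟩
      specialize ih (by omega)
      rw [Function.iterate_succ_apply', Function.iterate_succ_apply']
      have hX := hf.mapsTo_iterate i hx.1
      have hY := hf.mapsTo_iterate i hy.1
      have hXc := hx.2.2 i hi
      intro heq
      refine ih ?_
      rcases lt_or_gt_of_ne hXc with h | h
      · have h' : f^[i] y < c := by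
          rw [sign_neg (by linarith : f^[i] x - c < 0)] at hl
          have := sign_eq_neg_one_iff.1 hl.symm
          linarith
        exact hf.mono.injOn ⟨hX.1, h.le⟩ ⟨hY.1, h'.le⟩ heq
      · have h' : c < f^[i] y := by
          rw [sign_pos (by linarith : 0 < f^[i] x - c)] at hl
          have := sign_eq_one_iff.1 hl.symm
          linarith
        exact hf.anti.injOn ⟨h.le, hX.2⟩ ⟨h'.le, hY.2⟩ heq
  exact key j le_rfl (hx.2.1.trans hy.2.1.symm)

theorem itineraryCount_le_precritical (hf : IsUnimodalMax f c) (n : ℕ) :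
    itineraryCount f c n ≤ 2 * (precritical f c n).ncard + 1 := by
  have hK := hf.finite_precritical n
  set K := precritical f c n with hKdef
  have hsplit : itinerary f c n '' Icc (-1 : ℝ) 1 ⊆
      itinerary f c n '' K ∪ itinerary f c n '' (Icc (-1 : ℝ) 1 \ K) := by
    rintro _ ⟨x, hx, rfl⟩
    by_cases hxK : x ∈ K
    · exact Or.inl ⟨x, hxK, rfl⟩
    · exact Or.inr ⟨x, ⟨hx, hxK⟩, rfl⟩
  have h1 : (itinerary f c n '' K).ncard ≤ K.ncard := ncard_image_le hK
  set S := Icc (-1 : ℝ) 1 \ K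
  set g : ℝ → ℕ := fun x => (K ∩ Iio x).ncard with hg
  have hfac : ∀ x ∈ S, ∀ y ∈ S, x ≤ y → g x = g y → itinerary f c n x = itinerary f c n y := by
    intro x hx y hy hxy hgxy
    have heq : K ∩ Iio x = K ∩ Iio y :=
      eq_of_subset_of_ncard_le (inter_subset_inter_right _ (Iio_subset_Iio hxy)) hgxy.ge
        (hK.inter_of_left _)
    refine hf.itinerary_eq hx.1 hy.1 fun z hz hzK => ?_
    rw [uIcc_of_le hxy] at hz
    have hzy : z ∈ K ∩ Iio y := ⟨hzK, lt_of_le_of_ne hz.2 (by rintro rfl; exact hy.2 hzK)⟩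
    rw [← heq] at hzy
    exact absurd hz.1 (not_le.2 hzy.2)
  have hfac' : ∀ x ∈ S, ∀ y ∈ S, g x = g y → itinerary f c n x = itinerary f c n y := by
    intro x hx y hy h
    rcases le_total x y with hxy | hxy
    · exact hfac x hx y hy hxy h
    · exact (hfac y hy x hx hxy h.symm).symm
  have h2 : (itinerary f c n '' S).ncard ≤ K.ncard + 1 := by
    have hsub : itinerary f c n '' S ⊆
        (fun k => itinerary f c n (Function.invFunOn g S k)) '' (Finset.range (K.ncard + 1)) := by
      rintro _ ⟨x, hx, rfl⟩
      refine ⟨g x, ?_, ?_⟩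
      · rw [Finset.mem_coe, Finset.mem_range]
        exact Nat.lt_succ_of_le (ncard_le_ncard inter_subset_left hK)
      · have hex : ∃ a ∈ S, g a = g x := ⟨x, hx, rfl⟩
        exact hfac' _ (Function.invFunOn_mem hex) x hx (Function.invFunOn_eq hex)
    refine (ncard_le_ncard hsub (toFinite _)).trans ((ncard_image_le (toFinite _)).trans ?_)
    rw [ncard_coe_finset, Finset.card_range]
  have h3 := (ncard_le_ncard hsplit (toFinite _)).trans (ncard_union_le _ _)
  unfold itineraryCount
  omega

theorem ncard_precritical_le (hf : IsUnimodalMax f c) (n : ℕ) :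
    (precritical f c n).ncard ≤ ∑ j ∈ Finset.range n, (firstHit f c j).ncard := by
  induction n with
  | zero => simp [precritical]
  | succ n ih =>
    have hsub : precritical f c (n + 1) ⊆ precritical f c n ∪ firstHit f c n := by
      rintro x ⟨hx, i, hi, hxi⟩
      by_cases h : ∃ i < n, f^[i] x = c
      · exact Or.inl ⟨hx, h⟩
      · push Not at h
        have : i = n := by
          by_contra hne
          exact h i (by omega) hxi
        subst this
        exact Or.inr ⟨hx, hxi, h⟩
    rw [Finset.sum_range_succ]
    have := (ncard_le_ncard hsub ((hf.finite_precritical n).union (hf.finite_firstHit n))).trans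
      (ncard_union_le _ _)
    omega

theorem exp_mul_entropyOn_le_sum (hf : IsUnimodalMax f c) (n : ℕ) :
    Real.exp (n * entropyOn f (Icc (-1 : ℝ) 1)) ≤
      3 + 4 * ∑ j ∈ Finset.range n, (hitCount f c j : ℝ) := by
  have h1 : ∑ j ∈ Finset.range n, (firstHit f c j).ncard ≤
      1 + 2 * ∑ j ∈ Finset.range n, hitCount f c j := by
    rw [Finset.mul_sum]
    have : ∀ n, ∑ j ∈ Finset.range (n + 1), (firstHit f c j).ncard =
        1 + ∑ j ∈ Finset.range n, 2 * hitCount f c j := by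
      intro n
      rw [Finset.sum_range_succ', hf.firstHit_zero, ncard_singleton, add_comm]
      simp only [hf.ncard_firstHit_succ]
    refine le_trans ?_ (this n).le
    rw [Finset.sum_range_succ]
    omega
  have h2 := hf.itineraryCount_le_precritical n
  have h3 := hf.ncard_precritical_le n
  refine (hf.exp_mul_entropyOn_le n).trans ?_
  exact_mod_cast (by omega : itineraryCount f c n ≤ 3 + 4 * ∑ j ∈ Finset.range n, hitCount f c j)

theorem exists_hitCount_le_exp (hf : IsUnimodalMax f c) {δ : ℝ} (hδ : 0 < δ) :
    ∃ C : ℝ, ∀ n, (hitCount f c n : ℝ) ≤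
      C * Real.exp (n * (entropyOn f (Icc (-1 : ℝ) 1) + δ)) := by
  obtain ⟨C, hC⟩ := hf.exists_itineraryCount_le_exp hδ
  refine ⟨C, fun n => le_trans ?_ (hC n)⟩
  exact_mod_cast (ncard_le_ncard inter_subset_left (hf.finite_firstHit n)).trans
    (hf.ncard_firstHit_le n)

end IsUnimodalMax

/-- The generating function of a sign sequence `θ` read from time `n` on. -/
noncomputable def kneadingTail (θ : ℕ → ℝ) (n : ℕ) (z : ℝ) : ℝ :=
  ∑' i, θ n * θ (n + i) * z ^ i

section SignSequences

variable {θ : ℕ → ℝ}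

theorem abs_sign_mul (hθ : ∀ n, θ n = 1 ∨ θ n = -1) (m n : ℕ) : |θ m * θ n| = 1 := by
  rcases hθ m with h | h <;> rcases hθ n with h' | h' <;> rw [h, h'] <;> norm_num

theorem signSeq_mul_self (hθ : ∀ n, θ n = 1 ∨ θ n = -1) (n : ℕ) : θ n * θ n = 1 := by
  rcases hθ n with h | h <;> rw [h] <;> norm_num

theorem sign_mul_eq (hθ : ∀ n, θ n = 1 ∨ θ n = -1) (m n : ℕ) :
    θ m * θ n = 1 ∨ θ m * θ n = -1 := by
  rcases hθ m with h | h <;> rcases hθ n with h' | h' <;> rw [h, h'] <;> norm_num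

theorem summable_kneadingTail (hθ : ∀ n, θ n = 1 ∨ θ n = -1) (n : ℕ) {z : ℝ} (hz0 : 0 ≤ z)
    (hz1 : z < 1) : Summable fun i => θ n * θ (n + i) * z ^ i := by
  refine (summable_geometric_of_lt_one hz0 hz1).of_norm_bounded fun i => ?_
  rw [norm_mul, Real.norm_eq_abs, abs_sign_mul hθ, one_mul, norm_pow, Real.norm_of_nonneg hz0]

theorem kneadingTail_eq (hθ : ∀ n, θ n = 1 ∨ θ n = -1) (n : ℕ) {z : ℝ} (hz0 : 0 ≤ z)
    (hz1 : z < 1) :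
    kneadingTail θ n z = 1 + θ n * θ (n + 1) * z * kneadingTail θ (n + 1) z := by
  unfold kneadingTail
  rw [(summable_kneadingTail hθ n hz0 hz1).tsum_eq_zero_add, ← tsum_mul_left]
  congr 1
  · simp [signSeq_mul_self hθ]
  · congr 1
    ext i
    have h := signSeq_mul_self hθ (n + 1)
    rw [show n + (i + 1) = n + 1 + i by ring, pow_succ]
    linear_combination (-(θ n * θ (n + 1 + i) * z ^ i * z)) * h

theorem kneadingTail_double (hθ : ∀ n, θ n = 1 ∨ θ n = -1)
    (hodd : ∀ n, θ (2 * n + 1) = -θ (2 * n)) (n : ℕ) {z : ℝ} (hz0 : 0 ≤ z) (hz1 : z < 1) :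
    kneadingTail θ (2 * n) z = (1 - z) * kneadingTail (fun k => θ (2 * k)) n (z ^ 2) := by
  have hs := summable_kneadingTail hθ (2 * n) hz0 hz1
  unfold kneadingTail
  generalize hF : (fun i => θ (2 * n) * θ (2 * n + i) * z ^ i) = F at hs ⊢
  have he : Summable fun k => F (2 * k) :=
    hs.comp_injective fun a b h => by omega
  have ho : Summable fun k => F (2 * k + 1) :=
    hs.comp_injective (i := fun k => 2 * k + 1) fun a b (h : 2 * a + 1 = 2 * b + 1) => by omega
  rw [← tsum_even_add_odd he ho, ← he.tsum_add ho, ← tsum_mul_left]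
  refine tsum_congr fun k => ?_
  have h1 := hodd (n + k)
  rw [← hF]
  beta_reduce
  rw [show 2 * n + (2 * k + 1) = 2 * (n + k) + 1 by ring, h1,
    show 2 * n + 2 * k = 2 * (n + k) by ring, ← pow_mul]
  ring

theorem sign_odd_eq_neg (hθ : ∀ n, θ n = 1 ∨ θ n = -1) {r : ℝ} (hr0 : 0 < r) (hr1 : r < 1)
    (hr2 : 1 / 2 ≤ r ^ 2) (hnn : ∀ n, 0 ≤ kneadingTail θ n r) (h0 : kneadingTail θ 0 r = 0)
    (n : ℕ) : θ (2 * n + 1) = -θ (2 * n) := by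
  have key : ∀ n, kneadingTail θ (2 * n) r * r ^ 2 ≤ 1 - r → θ (2 * n) * θ (2 * n + 1) = -1 := by
    intro n hn
    refine (sign_mul_eq hθ _ _).resolve_left fun h => ?_
    have h1 := kneadingTail_eq hθ (2 * n) hr0.le hr1
    rw [h] at h1
    have h2 : 1 ≤ kneadingTail θ (2 * n) r := by
      rw [h1]
      have := mul_nonneg hr0.le (hnn (2 * n + 1))
      linarith
    nlinarith
  have inv : ∀ n, kneadingTail θ (2 * n) r * r ^ 2 ≤ 1 - r := by
    intro n
    induction n with
    | zero => rw [mul_zero, h0]; linarith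
    | succ n ih =>
      have h1 := kneadingTail_eq hθ (2 * n) hr0.le hr1
      have h2 := kneadingTail_eq hθ (2 * n + 1) hr0.le hr1
      rw [key n ih] at h1
      rw [show 2 * (n + 1) = 2 * n + 1 + 1 by ring]
      have hA := hnn (2 * n)
      set A := kneadingTail θ (2 * n) r
      set B := kneadingTail θ (2 * n + 1) r
      set E := kneadingTail θ (2 * n + 1 + 1) r
      rcases sign_mul_eq hθ (2 * n + 1) (2 * n + 1 + 1) with h | h <;> rw [h] at h2
      · have : E * r ^ 2 = 1 - A - r := by rw [h1, h2]; ring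
        linarith
      · have h3 : E * r ^ 2 = r - 1 + A := by rw [h1, h2]; ring
        nlinarith
  have := key n (inv n)
  rcases hθ (2 * n) with h | h <;> rw [h] at this ⊢ <;> linarith

theorem sign_doubling (m : ℕ) : ∀ (θ : ℕ → ℝ) (r : ℝ), (∀ n, θ n = 1 ∨ θ n = -1) → θ 0 = 1 →
    0 < r → r < 1 → 1 / 2 ≤ r ^ 2 ^ m → (∀ n, 0 ≤ kneadingTail θ n r) → kneadingTail θ 0 r = 0 →
    ∀ n, 2 * n + 1 < 2 ^ m → θ (2 * n) = θ n ∧ θ (2 * n + 1) = -θ n := by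
  induction m with
  | zero => intro θ r _ _ _ _ _ _ _ n hn; simp at hn
  | succ m ih =>
    intro θ r hθ hθ0 hr0 hr1 hrm hnn h0 n hn
    have hr2 : 1 / 2 ≤ r ^ 2 := by
      refine hrm.trans (pow_le_pow_of_le_one hr0.le hr1.le ?_)
      rw [pow_succ]
      have := Nat.one_le_two_pow (n := m)
      omega
    have hodd := sign_odd_eq_neg hθ hr0 hr1 hr2 hnn h0
    have hr21 : r ^ 2 < 1 := pow_lt_one₀ hr0.le hr1 two_ne_zero
    have hdbl := fun n => kneadingTail_double hθ hodd n hr0.le hr1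
    have ih' := ih (fun k => θ (2 * k)) (r ^ 2) (fun n => hθ _) hθ0 (by positivity) hr21
      (by rw [← pow_mul, ← pow_succ']; exact hrm)
      (fun n => by
        have := hnn (2 * n)
        rw [hdbl] at this
        exact nonneg_of_mul_nonneg_right this (by linarith))
      (by
        have := hdbl 0
        rw [mul_zero, h0] at this
        rcases mul_eq_zero.1 this.symm with h | h
        · linarith
        · exact h)
    have heven : θ (2 * n) = θ n := by
      rcases Nat.even_or_odd' n with ⟨k, rfl | rfl⟩
      · rcases Nat.eq_zero_or_pos k with rfl | hk
        · simp
        · refine (ih' k ?_).1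
          rcases m with _ | m
          · simp at hn; omega
          · rw [pow_succ, pow_succ] at hn
            rw [pow_succ]
            omega
      · have h1 := (ih' k (by rw [pow_succ] at hn; omega)).2
        rw [h1, hodd k]
    exact ⟨heven, by rw [hodd, heven]⟩

/-- A sign sequence with the self-similarity of the Thue–Morse sequence is not eventually
periodic. -/
theorem not_periodic_of_doubling (hθ : ∀ n, θ n = 1 ∨ θ n = -1)
    (hd : ∀ n, θ (2 * n) = θ n ∧ θ (2 * n + 1) = -θ n) (M : ℕ) (q : ℕ) (hq : 0 < q) :
    ¬ ∀ n ≥ M, θ (n + q) = θ n := by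
  induction q using Nat.strong_induction_on with
  | _ q ih =>
    intro hper
    rcases Nat.even_or_odd' q with ⟨k, rfl | rfl⟩
    · refine ih k (by omega) (by omega) fun n hn => ?_
      rw [← (hd (n + k)).1, ← (hd n).1, mul_add]
      exact hper _ (by omega)
    · have h1 := hper (2 * M) (by omega)
      have h2 := hper (2 * M + 1) (by omega)
      have h3 := hper (2 * M + 2) (by omega)
      have h4 := hper (2 * M + 3) (by omega)
      rw [show 2 * M + (2 * k + 1) = 2 * (M + k) + 1 by ring] at h1
      rw [show 2 * M + 1 + (2 * k + 1) = 2 * (M + k + 1) by ring] at h2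
      rw [show 2 * M + 2 + (2 * k + 1) = 2 * (M + k + 1) + 1 by ring,
        show 2 * M + 2 = 2 * (M + 1) by ring] at h3
      have e1 := hd (M + k)
      have e2 := hd (M + k + 1)
      have e3 := hd M
      have e4 := hd (M + 1)
      have g1 : θ (M + 1) = θ M := by linarith
      have h1' := hper (2 * (M + 1)) (by omega)
      have h2' := hper (2 * (M + 1) + 1) (by omega)
      have h3' := hper (2 * (M + 1) + 2) (by omega)
      rw [show 2 * (M + 1) + (2 * k + 1) = 2 * (M + 1 + k) + 1 by ring] at h1'
      rw [show 2 * (M + 1) + 1 + (2 * k + 1) = 2 * (M + 1 + k + 1) by ring] at h2'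
      rw [show 2 * (M + 1) + 2 + (2 * k + 1) = 2 * (M + 1 + k + 1) + 1 by ring,
        show 2 * (M + 1) + 2 = 2 * (M + 1 + 1) by ring] at h3'
      have e1' := hd (M + 1 + k)
      have e2' := hd (M + 1 + k + 1)
      have e4' := hd (M + 1 + 1)
      have g2 : θ (M + 1 + 1) = θ (M + 1) := by linarith
      rcases Nat.even_or_odd' M with ⟨l, hl | hl⟩
      · have := hd l
        rw [← hl] at this
        rcases hθ l with h | h <;> linarith
      · have := hd (l + 1)
        rw [show 2 * (l + 1) = M + 1 by omega] at this
        rcases hθ (l + 1) with h | h <;> linarith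

theorem analyticOnNhd_kneadingTail (hθ : ∀ n, θ n = 1 ∨ θ n = -1) (n : ℕ) :
    AnalyticOnNhd ℝ (kneadingTail θ n) (Metric.ball 0 1) := by
  set a : ℕ → ℝ := fun i => θ n * θ (n + i) with ha
  have hrad : 1 ≤ (FormalMultilinearSeries.ofScalars ℝ a).radius := by
    refine ENNReal.le_of_forall_nnreal_lt fun r hr => ?_
    refine FormalMultilinearSeries.le_radius_of_bound _ 1 fun i => ?_
    rw [FormalMultilinearSeries.ofScalars_norm, Real.norm_eq_abs, abs_sign_mul hθ, one_mul]
    exact pow_le_one₀ r.2 (by exact_mod_cast hr.le)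
  have hps := (FormalMultilinearSeries.ofScalars ℝ a).hasFPowerSeriesOnBall
    (lt_of_lt_of_le one_pos hrad)
  have heq : (FormalMultilinearSeries.ofScalars ℝ a).sum = kneadingTail θ n := by
    ext z
    have := FormalMultilinearSeries.ofScalars_sum_eq (E := ℝ) a z
    simpa [FormalMultilinearSeries.ofScalarsSum, kneadingTail, ha] using this
  rw [heq] at hps
  refine hps.analyticOnNhd.mono fun z hz => ?_
  rw [Metric.mem_ball, dist_zero_right] at hz
  refine lt_of_lt_of_le ?_ hrad
  rw [edist_zero_right, ← ofReal_norm]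
  exact ENNReal.ofReal_lt_one.2 hz

theorem continuousAt_kneadingTail (hθ : ∀ n, θ n = 1 ∨ θ n = -1) (n : ℕ) {z : ℝ} (hz0 : 0 ≤ z)
    (hz1 : z < 1) : ContinuousAt (kneadingTail θ n) z :=
  (analyticOnNhd_kneadingTail hθ n z
    (by rwa [Metric.mem_ball, dist_zero_right, Real.norm_of_nonneg hz0])).continuousAt

theorem abs_kneadingTail_sub_le {θ' : ℕ → ℝ} (hθ : ∀ n, θ n = 1 ∨ θ n = -1)
    (hθ' : ∀ n, θ' n = 1 ∨ θ' n = -1) {N : ℕ} (h : ∀ n ≤ N, θ n = θ' n) {z ρ : ℝ} (hz0 : 0 ≤ z)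
    (hzρ : z ≤ ρ) (hρ : ρ < 1) :
    |kneadingTail θ 0 z - kneadingTail θ' 0 z| ≤ 2 / (1 - ρ) * ρ ^ N := by
  have hz1 := hzρ.trans_lt hρ
  have hs := (summable_kneadingTail hθ 0 hz0 hz1).sub (summable_kneadingTail hθ' 0 hz0 hz1)
  unfold kneadingTail
  rw [← (summable_kneadingTail hθ 0 hz0 hz1).tsum_sub (summable_kneadingTail hθ' 0 hz0 hz1),
    ← hs.sum_add_tsum_nat_add N, Finset.sum_eq_zero, zero_add]
  · have hg := (summable_geometric_of_lt_one (hz0.trans hzρ) hρ).mul_left (2 * ρ ^ N)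
    have hg2 := tsum_mul_left (a := 2 * ρ ^ N) (f := fun i : ℕ => ρ ^ i)
      (L := SummationFilter.unconditional ℕ)
    rw [tsum_geometric_of_lt_one (hz0.trans hzρ) hρ] at hg2
    have hb := tsum_of_norm_bounded (hg.hasSum) (f := fun k => θ 0 * θ (0 + (k + N)) * z ^ (k + N) -
      θ' 0 * θ' (0 + (k + N)) * z ^ (k + N)) fun k => ?_
    · refine hb.trans_eq ?_
      rw [hg2]; ring
    · rw [Real.norm_eq_abs, ← sub_mul, abs_mul, abs_of_nonneg (pow_nonneg hz0 _)]
      have h1 : |θ 0 * θ (0 + (k + N)) - θ' 0 * θ' (0 + (k + N))| ≤ 2 := by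
        refine (abs_sub _ _).trans ?_
        rw [abs_sign_mul hθ, abs_sign_mul hθ']; norm_num
      have h2 : z ^ (k + N) ≤ ρ ^ N * ρ ^ k := by
        rw [← pow_add, add_comm N k]
        exact pow_le_pow_left₀ hz0 hzρ _
      calc _ ≤ 2 * (ρ ^ N * ρ ^ k) := by gcongr
        _ = _ := by ring
  · intro i hi
    rw [Finset.mem_range] at hi
    rw [zero_add, h i hi.le, h 0 (by omega), sub_self]

end SignSequences

/-- The normalized generating function of the first-hit counts. -/
noncomputable def hitSeries (f : ℝ → ℝ) (c z : ℝ) : ℝ :=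
  1 / 2 + z * ∑' j, (hitCount f c j : ℝ) * z ^ j

namespace IsUnimodalMax

variable {f : ℝ → ℝ} {c : ℝ}

theorem summable_hitCount (hf : IsUnimodalMax f c) {z : ℝ} (hz0 : 0 < z)
    (hz : z < Real.exp (-entropyOn f (Icc (-1 : ℝ) 1))) :
    Summable fun j => (hitCount f c j : ℝ) * z ^ j := by
  set h := entropyOn f (Icc (-1 : ℝ) 1) with hh
  have hlog : Real.log z < -h := (Real.log_lt_iff_lt_exp hz0).2 hz
  set δ := (-h - Real.log z) / 2 with hδ
  have hδ0 : 0 < δ := by rw [hδ]; linarith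
  obtain ⟨C, hC⟩ := hf.exists_hitCount_le_exp hδ0
  have hq : Real.exp (h + δ) * z < 1 := by
    rw [← Real.exp_log hz0, ← Real.exp_add, Real.exp_lt_one_iff]
    linarith
  refine ((summable_geometric_of_lt_one (by positivity) hq).mul_left C).of_nonneg_of_le
    (fun j => by positivity) fun j => ?_
  rw [mul_pow, ← mul_assoc, ← Real.exp_nat_mul]
  gcongr
  exact hC j

theorem exp_neg_entropyOn_le_one (hf : IsUnimodalMax f c) :
    Real.exp (-entropyOn f (Icc (-1 : ℝ) 1)) ≤ 1 :=
  Real.exp_le_one_iff.2 (neg_nonpos.2 hf.entropyOn_nonneg)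

theorem half_le_hitSeries (f : ℝ → ℝ) (c : ℝ) {z : ℝ} (hz0 : 0 < z) :
    1 / 2 ≤ hitSeries f c z := by
  have : 0 ≤ z * ∑' j, (hitCount f c j : ℝ) * z ^ j :=
    mul_nonneg hz0.le (tsum_nonneg fun j => by positivity)
  rw [hitSeries]
  linarith

theorem hitSeries_mono (hf : IsUnimodalMax f c) {x y : ℝ} (hx : 0 < x) (hxy : x ≤ y)
    (hy : y < Real.exp (-entropyOn f (Icc (-1 : ℝ) 1))) :
    hitSeries f c x ≤ hitSeries f c y := by
  unfold hitSeries
  have : ∑' j, (hitCount f c j : ℝ) * x ^ j ≤ ∑' j, (hitCount f c j : ℝ) * y ^ j :=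
    (hf.summable_hitCount hx (hxy.trans_lt hy)).tsum_le_tsum (fun j => by gcongr)
      (hf.summable_hitCount (hx.trans_le hxy) hy)
  have h0 : 0 ≤ ∑' j, (hitCount f c j : ℝ) * x ^ j := tsum_nonneg fun j => by positivity
  have hy0 : 0 ≤ y := (hx.trans_le hxy).le
  gcongr

theorem exists_remainder (hf : IsUnimodalMax f c) {z : ℝ} (hz0 : 0 < z)
    (hz : z < Real.exp (-entropyOn f (Icc (-1 : ℝ) 1))) :
    ∃ X : ℕ → ℝ, X 0 = 1 / 2 ∧ (∀ n, 1 / 2 ≤ X n) ∧ (∀ n, X n ≤ hitSeries f c z) ∧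
      ∀ n, X n = (1 - z) * hitSeries f c z +
        kneadingSign f c n * kneadingSign f c (n + 1) * z * X (n + 1) := by
  have hb := hf.summable_hitCount hz0 hz
  have hB : ∀ n, Summable fun j => (hitCountBelow f c n j : ℝ) * z ^ j := fun n =>
    hb.of_nonneg_of_le (fun j => by positivity) fun j => by
      gcongr
      exact hf.hitCountBelow_le n j
  refine ⟨fun n => hitSeries f c z - z * ∑' j, (hitCountBelow f c n j : ℝ) * z ^ j,
    ?_, fun n => ?_, fun n => ?_, fun n => ?_⟩
  · simp only [hitSeries, hitCountBelow_zero_left]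
    ring
  · have : ∑' j, (hitCountBelow f c n j : ℝ) * z ^ j ≤ ∑' j, (hitCount f c j : ℝ) * z ^ j :=
      (hB n).tsum_le_tsum (fun j => by gcongr; exact hf.hitCountBelow_le n j) hb
    have := mul_le_mul_of_nonneg_left this hz0.le
    simp only [hitSeries]
    linarith
  · have : 0 ≤ z * ∑' j, (hitCountBelow f c n j : ℝ) * z ^ j :=
      mul_nonneg hz0.le (tsum_nonneg fun j => by positivity)
    linarith
  · have h1 := (hB n).tsum_eq_zero_add
    rw [hf.hitCountBelow_zero_right, pow_zero, mul_one] at h1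
    set e := kneadingSign f c n * kneadingSign f c (n + 1)
    have h2 : ∑' j, (hitCountBelow f c n (j + 1) : ℝ) * z ^ (j + 1) =
        z * e * ∑' j, (hitCountBelow f c (n + 1) j : ℝ) * z ^ j +
          z * (1 - e) * ∑' j, (hitCount f c j : ℝ) * z ^ j := by
      rw [← tsum_mul_left, ← tsum_mul_left, ← ((hB (n + 1)).mul_left _).tsum_add (hb.mul_left _)]
      refine tsum_congr fun j => ?_
      rw [hf.hitCountBelow_succ]
      ring
    rw [h2] at h1
    beta_reduce
    rw [h1]
    simp only [hitSeries]
    ring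

theorem one_sub_mul_hitSeries_mul_kneadingTail (hf : IsUnimodalMax f c) {z : ℝ} (hz0 : 0 < z)
    (hz : z < Real.exp (-entropyOn f (Icc (-1 : ℝ) 1))) :
    (1 - z) * hitSeries f c z * kneadingTail (kneadingSign f c) 0 z = 1 / 2 ∧
      ∀ n, 1 / 2 ≤ (1 - z) * hitSeries f c z * kneadingTail (kneadingSign f c) n z := by
  have hz1 : z < 1 := hz.trans_le hf.exp_neg_entropyOn_le_one
  obtain ⟨X, hX0, hXl, hXu, hX⟩ := hf.exists_remainder hz0 hz
  have hθ := kneadingSign_eq f c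
  have key : ∀ n, (1 - z) * hitSeries f c z * kneadingTail (kneadingSign f c) n z = X n := by
    intro n
    set A := (1 - z) * hitSeries f c z
    have hpart : ∀ N, X n = A * ∑ i ∈ Finset.range N,
        kneadingSign f c n * kneadingSign f c (n + i) * z ^ i +
          kneadingSign f c n * kneadingSign f c (n + N) * z ^ N * X (n + N) := by
      intro N
      induction N with
      | zero => simp [signSeq_mul_self hθ]
      | succ N ih =>
        have h1 := hX (n + N)
        have h2 := signSeq_mul_self hθ (n + N)
        rw [Finset.sum_range_succ, ih]
        conv_lhs => rw [h1]
        rw [← add_assoc n N 1]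
        linear_combination (kneadingSign f c n * kneadingSign f c (n + N + 1) * z ^ (N + 1) *
          X (n + N + 1)) * h2
    have hlim1 := ((summable_kneadingTail hθ n hz0.le hz1).hasSum.tendsto_sum_nat).const_mul A
    have hlim2 : Tendsto (fun N => kneadingSign f c n * kneadingSign f c (n + N) * z ^ N *
        X (n + N)) atTop (nhds 0) := by
      refine squeeze_zero_norm (a := fun N => z ^ N * hitSeries f c z) (fun N => ?_) ?_
      · rw [norm_mul, norm_mul, Real.norm_eq_abs, abs_sign_mul hθ, one_mul,
          Real.norm_of_nonneg (by positivity : 0 ≤ z ^ N), Real.norm_of_nonneg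
            (by linarith [hXl (n + N)])]
        gcongr
        exact hXu _
      · simpa using (tendsto_pow_atTop_nhds_zero_of_lt_one hz0.le hz1).mul_const (hitSeries f c z)
    have hlim := hlim1.add hlim2
    simp only [← hpart, add_zero] at hlim
    exact (tendsto_nhds_unique hlim tendsto_const_nhds)
  exact ⟨by rw [key, hX0], fun n => by rw [key]; exact hXl n⟩

theorem one_sub_mul_hitSeries_pos (hf : IsUnimodalMax f c) {z : ℝ} (hz0 : 0 < z)
    (hz : z < Real.exp (-entropyOn f (Icc (-1 : ℝ) 1))) : 0 < (1 - z) * hitSeries f c z := by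
  have := half_le_hitSeries f c hz0
  have := hz.trans_le hf.exp_neg_entropyOn_le_one
  exact mul_pos (by linarith) (by linarith)

theorem kneadingTail_pos (hf : IsUnimodalMax f c) {z : ℝ} (hz0 : 0 < z)
    (hz : z < Real.exp (-entropyOn f (Icc (-1 : ℝ) 1))) (n : ℕ) :
    0 < kneadingTail (kneadingSign f c) n z := by
  have h1 := (hf.one_sub_mul_hitSeries_mul_kneadingTail hz0 hz).2 n
  exact pos_of_mul_pos_right (by linarith) (hf.one_sub_mul_hitSeries_pos hz0 hz).le

theorem kneadingTail_mul_one_sub_anti (hf : IsUnimodalMax f c) {x y : ℝ} (hx : 0 < x)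
    (hxy : x ≤ y) (hy : y < Real.exp (-entropyOn f (Icc (-1 : ℝ) 1))) :
    (1 - y) * kneadingTail (kneadingSign f c) 0 y ≤
      (1 - x) * kneadingTail (kneadingSign f c) 0 x := by
  have h1 := (hf.one_sub_mul_hitSeries_mul_kneadingTail hx (hxy.trans_lt hy)).1
  have h2 := (hf.one_sub_mul_hitSeries_mul_kneadingTail (hx.trans_le hxy) hy).1
  have h3 := half_le_hitSeries f c hx
  have h4 := hf.hitSeries_mono hx hxy hy
  have e1 : (1 - x) * kneadingTail (kneadingSign f c) 0 x = 1 / 2 / hitSeries f c x := by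
    rw [eq_div_iff (by linarith)]; linarith
  have e2 : (1 - y) * kneadingTail (kneadingSign f c) 0 y = 1 / 2 / hitSeries f c y := by
    rw [eq_div_iff (by linarith)]; linarith
  rw [e1, e2]
  gcongr

theorem sum_le_hitSeries (hf : IsUnimodalMax f c) {z : ℝ} (hz0 : 0 < z)
    (hz : z < Real.exp (-entropyOn f (Icc (-1 : ℝ) 1))) (N : ℕ) :
    (1 - z) * ∑ n ∈ Finset.range N,
      (Real.exp (n * entropyOn f (Icc (-1 : ℝ) 1)) - 3) / 4 * z ^ n ≤ hitSeries f c z := by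
  have hz1 : z < 1 := hz.trans_le hf.exp_neg_entropyOn_le_one
  set T : ℕ → ℝ := fun n => ∑ j ∈ Finset.range n, (hitCount f c j : ℝ)
  have habel : ∀ N, (1 - z) * ∑ n ∈ Finset.range N, T n * z ^ n + T N * z ^ N =
      z * ∑ n ∈ Finset.range N, (hitCount f c n : ℝ) * z ^ n := by
    intro N
    induction N with
    | zero => simp [T]
    | succ N ih =>
      have : T (N + 1) = T N + hitCount f c N := Finset.sum_range_succ _ _
      rw [Finset.sum_range_succ, Finset.sum_range_succ, this]
      linear_combination ih
  have h1 : ∑ n ∈ Finset.range N,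
      (Real.exp (n * entropyOn f (Icc (-1 : ℝ) 1)) - 3) / 4 * z ^ n ≤
        ∑ n ∈ Finset.range N, T n * z ^ n := by
    refine Finset.sum_le_sum fun n _ => ?_
    gcongr
    have := hf.exp_mul_entropyOn_le_sum n
    simp only [T]
    linarith
  have h2 : ∑ n ∈ Finset.range N, (hitCount f c n : ℝ) * z ^ n ≤
      ∑' n, (hitCount f c n : ℝ) * z ^ n :=
    (hf.summable_hitCount hz0 hz).sum_le_tsum _ fun n _ => by positivity
  have h3 : 0 ≤ T N * z ^ N := by positivity
  have h4 := mul_le_mul_of_nonneg_left h1 (by linarith : 0 ≤ 1 - z)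
  have h5 := mul_le_mul_of_nonneg_left h2 hz0.le
  have := habel N
  rw [hitSeries]
  linarith

theorem kneadingTail_exp_neg_nonneg (hf : IsUnimodalMax f c)
    (hh : 0 < entropyOn f (Icc (-1 : ℝ) 1)) (n : ℕ) :
    0 ≤ kneadingTail (kneadingSign f c) n (Real.exp (-entropyOn f (Icc (-1 : ℝ) 1))) := by
  have hr1 : Real.exp (-entropyOn f (Icc (-1 : ℝ) 1)) < 1 := by
    rw [Real.exp_lt_one_iff]; linarith
  have hcont := (continuousAt_kneadingTail (kneadingSign_eq f c) n (Real.exp_pos _).le hr1)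
  refine ge_of_tendsto (hcont.tendsto.mono_left
    (nhdsWithin_le_nhds (s := Iio (Real.exp (-entropyOn f (Icc (-1 : ℝ) 1)))))) ?_
  filter_upwards [Ioo_mem_nhdsLT (Real.exp_pos (-entropyOn f (Icc (-1 : ℝ) 1)))] with z hz
  exact (hf.kneadingTail_pos hz.1 hz.2 n).le

theorem kneadingTail_exp_neg_eq_zero (hf : IsUnimodalMax f c)
    (hh : 0 < entropyOn f (Icc (-1 : ℝ) 1)) :
    kneadingTail (kneadingSign f c) 0 (Real.exp (-entropyOn f (Icc (-1 : ℝ) 1))) = 0 := by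
  refine le_antisymm ?_ (hf.kneadingTail_exp_neg_nonneg hh 0)
  set h := entropyOn f (Icc (-1 : ℝ) 1) with hdef
  set r := Real.exp (-h) with hr
  have hr0 : 0 < r := Real.exp_pos _
  have hr1 : r < 1 := by
    rw [hr, Real.exp_lt_one_iff]; linarith
  have hcont := continuousAt_kneadingTail (kneadingSign_eq f c) 0 hr0.le hr1
  set D := kneadingTail (kneadingSign f c) 0
  have hN : ∀ N : ℕ, (1 - r) * ((1 - r) * ∑ n ∈ Finset.range N,
      (Real.exp (n * h) - 3) / 4 * r ^ n) * D r ≤ 1 / 2 := by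
    intro N
    have hc : ContinuousAt (fun z => (1 - z) * ((1 - z) * ∑ n ∈ Finset.range N,
        (Real.exp (n * h) - 3) / 4 * z ^ n) * D z) r := by
      refine ContinuousAt.mul ?_ hcont
      fun_prop
    refine le_of_tendsto (hc.tendsto.mono_left (nhdsWithin_le_nhds (s := Iio r))) ?_
    filter_upwards [Ioo_mem_nhdsLT hr0] with z hz
    rw [← (hf.one_sub_mul_hitSeries_mul_kneadingTail hz.1 hz.2).1]
    have h1 := hf.kneadingTail_pos hz.1 hz.2 0
    have h2 := hf.sum_le_hitSeries hz.1 hz.2 N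
    have h3 : 0 ≤ 1 - z := by linarith [hz.2]
    exact mul_le_mul_of_nonneg_right (mul_le_mul_of_nonneg_left h2 h3) h1.le
  have hsum : ∀ N : ℕ, ((N : ℝ) - 3 / (1 - r)) / 4 ≤ ∑ n ∈ Finset.range N,
      (Real.exp (n * h) - 3) / 4 * r ^ n := by
    intro N
    have h1 : ∀ n : ℕ, (Real.exp (n * h) - 3) / 4 * r ^ n = 1 / 4 - 3 / 4 * r ^ n := by
      intro n
      have : Real.exp (n * h) * r ^ n = 1 := by
        rw [hr, ← Real.exp_nat_mul, ← Real.exp_add]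
        simp
      linear_combination this / 4
    simp only [h1]
    rw [Finset.sum_sub_distrib, ← Finset.mul_sum]
    have h2 : ∑ n ∈ Finset.range N, r ^ n ≤ 1 / (1 - r) := by
      rw [one_div, ← tsum_geometric_of_lt_one hr0.le hr1]
      exact (summable_geometric_of_lt_one hr0.le hr1).sum_le_tsum _ fun n _ => by positivity
    simp only [Finset.sum_const, Finset.card_range, nsmul_eq_mul]
    have : 3 / (1 - r) = 3 * (1 / (1 - r)) := by ring
    rw [this]
    linarith
  by_contra hD
  push Not at hD
  have h1r : 0 < 1 - r := by linarith
  obtain ⟨N, hNbig⟩ := exists_nat_gt (3 / (1 - r) + 2 / ((1 - r) * (1 - r) * D r))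
  have h1 : 1 / 2 < ((N : ℝ) - 3 / (1 - r)) / 4 * ((1 - r) * (1 - r) * D r) := by
    have hp : 0 < (1 - r) * (1 - r) * D r := by positivity
    have h2 : 2 / ((1 - r) * (1 - r) * D r) < N - 3 / (1 - r) := by linarith
    rw [div_lt_iff₀ hp] at h2
    linarith
  have h2 : ((N : ℝ) - 3 / (1 - r)) / 4 * ((1 - r) * (1 - r) * D r) ≤
      (∑ n ∈ Finset.range N, (Real.exp (n * h) - 3) / 4 * r ^ n) * ((1 - r) * (1 - r) * D r) :=
    mul_le_mul_of_nonneg_right (hsum N) (by positivity)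
  have h3 := hN N
  linarith

theorem entropyOn_le_log_three (hf : IsUnimodalMax f c) :
    entropyOn f (Icc (-1 : ℝ) 1) ≤ Real.log 3 := by
  have h1 := hf.exp_mul_entropyOn_le 1
  have h2 : (itineraryCount f c 1 : ℝ) ≤ 3 := by
    exact_mod_cast itineraryCount_le f c 1
  rw [Real.le_log_iff_exp_le (by norm_num)]
  simpa using h1.trans h2

end IsUnimodalMax

/-- An analytic function that is positive to the left of a zero `r` vanishes there to finite
order, which gives a lower bound slightly beyond `r`. -/
theorem exists_pow_le_abs_of_analytic {D : ℝ → ℝ} (hD : AnalyticOnNhd ℝ D (Metric.ball 0 1))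
    {r : ℝ} (hr0 : 0 < r) (hr1 : r < 1) (hpos : ∀ z, 0 ≤ z → z < r → 0 < D z) (hDr : D r = 0) :
    ∃ ρ κ : ℝ, ∃ m : ℕ, r < ρ ∧ ρ < 1 ∧ 0 < κ ∧ m ≠ 0 ∧
      ∀ z, 0 ≤ z → z ≤ ρ → κ * |z - r| ^ m ≤ |D z| := by
  have hball : ∀ z : ℝ, 0 ≤ z → z < 1 → z ∈ Metric.ball (0 : ℝ) 1 := fun z h0 h1 => by
    rwa [Metric.mem_ball, dist_zero_right, Real.norm_of_nonneg h0]
  have hAn := hD r (hball r hr0.le hr1)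
  have hne : ¬ ∀ᶠ z in nhds r, D z = 0 := by
    intro hev
    have := hD.eqOn_zero_of_preconnected_of_eventuallyEq_zero
      (convex_ball (0 : ℝ) 1).isPreconnected (hball r hr0.le hr1) hev (hball 0 le_rfl one_pos)
    exact (hpos 0 le_rfl hr0).ne' this
  obtain ⟨m, g, hg, hgr, heq⟩ := hAn.exists_eventuallyEq_pow_smul_nonzero_iff.2 hne
  have hm : m ≠ 0 := by
    rintro rfl
    have := heq.self_of_nhds
    rw [hDr, pow_zero, one_smul] at this
    exact hgr this.symm
  have hgabs : ∀ᶠ z in nhds r, |g r| / 2 < |g z| :=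
    (hg.continuousAt.abs).eventually (lt_mem_nhds (half_lt_self (abs_pos.2 hgr)))
  obtain ⟨η, hη, hηp⟩ := Metric.eventually_nhds_iff.1 (heq.and hgabs)
  set ξ := min (η / 2) ((1 - r) / 2) with hξ
  have hξ0 : 0 < ξ := lt_min (by linarith) (by linarith)
  have hξη : ξ < η := (min_le_left _ _).trans_lt (by linarith)
  have hξr : ξ ≤ (1 - r) / 2 := min_le_right _ _
  obtain ⟨κ', hκ', hκ⟩ : ∃ κ' > 0, ∀ z ∈ Icc 0 (r - ξ), κ' ≤ D z := by
    by_cases hne : (Icc 0 (r - ξ)).Nonempty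
    · have hcont : ContinuousOn D (Icc 0 (r - ξ)) := fun z hz =>
        (hD z (hball z hz.1 (by linarith [hz.2]))).continuousAt.continuousWithinAt
      obtain ⟨w, hw, hmin⟩ := isCompact_Icc.exists_isMinOn hne hcont
      exact ⟨D w, hpos w hw.1 (by linarith [hw.2]), fun z hz => hmin hz⟩
    · exact ⟨1, one_pos, fun z hz => (hne ⟨z, hz⟩).elim⟩
  refine ⟨r + ξ, min κ' (|g r| / 2), m, by linarith, by linarith,
    lt_min hκ' (half_pos (abs_pos.2 hgr)), hm, fun z hz0 hz => ?_⟩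
  by_cases hzr : z ≤ r - ξ
  · have h1 : |z - r| ≤ 1 := by rw [abs_le]; constructor <;> linarith
    calc min κ' (|g r| / 2) * |z - r| ^ m ≤ κ' * 1 := by
          gcongr
          · exact min_le_left _ _
          · exact pow_le_one₀ (abs_nonneg _) h1
      _ ≤ D z := by rw [mul_one]; exact hκ z ⟨hz0, hzr⟩
      _ ≤ |D z| := le_abs_self _
  · push Not at hzr
    have hd : dist z r < η := by
      rw [Real.dist_eq, abs_lt]; constructor <;> linarith
    obtain ⟨h1, h2⟩ := hηp hd
    rw [h1, smul_eq_mul, abs_mul, abs_pow, mul_comm]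
    gcongr
    exact (min_le_right _ _).trans h2.le

theorem exists_mul_pow_le_exp {A ρ : ℝ} (hρ0 : 0 < ρ) (hρ1 : ρ < 1) {m : ℕ} (hm : m ≠ 0) :
    ∃ C > 0, ∃ N₀ : ℕ, ∀ N ≥ N₀, ∀ x : ℝ, x ^ m ≤ A * ρ ^ N → x ≤ Real.exp (-(C * N)) := by
  have hl : Real.log ρ < 0 := Real.log_neg hρ0 hρ1
  have hm' : (0 : ℝ) < m := by positivity
  have hlim : Tendsto (fun N : ℕ => A * Real.sqrt ρ ^ N) atTop (nhds 0) := by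
    have h1 : Real.sqrt ρ < 1 := by rw [Real.sqrt_lt' one_pos]; simpa using hρ1
    simpa using (tendsto_pow_atTop_nhds_zero_of_lt_one (Real.sqrt_nonneg ρ) h1).const_mul A
  obtain ⟨N₀, hN₀⟩ := eventually_atTop.1 (hlim.eventually (ge_mem_nhds one_pos))
  refine ⟨-Real.log ρ / (2 * m), by apply div_pos <;> linarith, N₀, fun N hN x hx => ?_⟩
  refine le_of_pow_le_pow_left₀ hm (Real.exp_pos _).le (hx.trans ?_)
  have h1 : Real.exp (-(-Real.log ρ / (2 * m) * N)) ^ m = Real.sqrt ρ ^ N := by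
    rw [Real.sqrt_eq_rpow, Real.rpow_def_of_pos hρ0, ← Real.exp_nat_mul, ← Real.exp_nat_mul]
    congr 1
    field_simp
  have h2 : ρ ^ N = Real.sqrt ρ ^ N * Real.sqrt ρ ^ N := by
    rw [← mul_pow, Real.mul_self_sqrt hρ0.le]
  rw [h1, h2, ← mul_assoc]
  exact mul_le_of_le_one_left (by positivity) (hN₀ N hN)

namespace IsUnimodalMax

variable {f₀ : ℝ → ℝ} {c₀ : ℝ}

theorem kneadingTail_zero (f : ℝ → ℝ) (c : ℝ) : kneadingTail (kneadingSign f c) 0 0 = 1 := by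
  rw [kneadingTail_eq (kneadingSign_eq f c) 0 le_rfl one_pos]
  ring

theorem exists_entropyOn_eq_zero (hf₀ : IsUnimodalMax f₀ c₀)
    (h₀ : entropyOn f₀ (Icc (-1 : ℝ) 1) = 0)
    (hTM : ∃ n, ¬ (kneadingSign f₀ c₀ (2 * n) = kneadingSign f₀ c₀ n ∧
      kneadingSign f₀ c₀ (2 * n + 1) = -kneadingSign f₀ c₀ n)) :
    ∃ N₀ : ℕ, ∀ N ≥ N₀, ∀ f c, IsUnimodalMax f c →
      (∀ n ≤ N, kneadingSign f c n = kneadingSign f₀ c₀ n) →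
        entropyOn f (Icc (-1 : ℝ) 1) = 0 := by
  obtain ⟨n₀, hn₀⟩ := hTM
  obtain ⟨m, hm⟩ : ∃ m, 2 * n₀ + 1 < 2 ^ m := ⟨2 * n₀ + 1, Nat.lt_two_pow_self⟩
  obtain ⟨ρ, hρ, hρ0, hρ1⟩ : ∃ ρ : ℝ, 1 / 2 < ρ ^ 2 ^ m ∧ 0 < ρ ∧ ρ < 1 := by
    have hc : ContinuousAt (fun z : ℝ => z ^ 2 ^ m) 1 := by fun_prop
    have h1 : ∀ᶠ z in nhds (1 : ℝ), 1 / 2 < z ^ 2 ^ m :=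
      hc.eventually (lt_mem_nhds (by norm_num))
    have h2 := (h1.filter_mono (nhdsWithin_le_nhds (s := Iio 1))).and
      (Ioo_mem_nhdsLT (show (0 : ℝ) < 1 by norm_num))
    obtain ⟨z, h3, h4⟩ := h2.exists
    exact ⟨z, h3, h4.1, h4.2⟩
  have hθ₀ := kneadingSign_eq f₀ c₀
  obtain ⟨κ, hκ0, hκ⟩ : ∃ κ > 0, ∀ z ∈ Icc 0 ρ, κ ≤ kneadingTail (kneadingSign f₀ c₀) 0 z := by
    have hcont : ContinuousOn (kneadingTail (kneadingSign f₀ c₀) 0) (Icc 0 ρ) := fun z hz =>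
      (continuousAt_kneadingTail hθ₀ 0 hz.1 (hz.2.trans_lt hρ1)).continuousWithinAt
    obtain ⟨w, hw, hmin⟩ := isCompact_Icc.exists_isMinOn ⟨0, le_rfl, hρ0.le⟩ hcont
    refine ⟨_, ?_, fun z hz => hmin hz⟩
    rcases hw.1.eq_or_lt with h | h
    · rw [← h, kneadingTail_zero]; exact one_pos
    · refine hf₀.kneadingTail_pos h ?_ 0
      rw [h₀, neg_zero, Real.exp_zero]
      exact hw.2.trans_lt hρ1
  have hlim : Tendsto (fun N : ℕ => 2 / (1 - ρ) * ρ ^ N) atTop (nhds 0) := by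
    simpa using (tendsto_pow_atTop_nhds_zero_of_lt_one hρ0.le hρ1).const_mul (2 / (1 - ρ))
  obtain ⟨N₁, hN₁⟩ := eventually_atTop.1 (hlim.eventually (gt_mem_nhds hκ0))
  refine ⟨max N₁ (2 * n₀ + 1), fun N hN f c hf hagree => ?_⟩
  by_contra hne
  have hpos := lt_of_le_of_ne hf.entropyOn_nonneg (Ne.symm hne)
  have hz := hf.kneadingTail_exp_neg_eq_zero hpos
  have hnn := hf.kneadingTail_exp_neg_nonneg hpos
  have hr0 := Real.exp_pos (-entropyOn f (Icc (-1 : ℝ) 1))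
  have hr1 : Real.exp (-entropyOn f (Icc (-1 : ℝ) 1)) < 1 := by
    rw [Real.exp_lt_one_iff]; linarith
  set r := Real.exp (-entropyOn f (Icc (-1 : ℝ) 1))
  have hθ := kneadingSign_eq f c
  have hrρ : r ≤ ρ := by
    by_contra hcon
    push Not at hcon
    have h1 : 1 / 2 ≤ r ^ 2 ^ m := hρ.le.trans (pow_le_pow_left₀ hρ0.le hcon.le _)
    have h2 := sign_doubling m _ r hθ rfl hr0 hr1 h1 hnn hz n₀ hm
    have hN' := le_trans (le_max_right _ _) hN
    rw [hagree _ (by omega), hagree _ (by omega), hagree _ (by omega)] at h2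
    exact hn₀ h2
  have h1 := abs_kneadingTail_sub_le hθ hθ₀ hagree hr0.le hrρ hρ1
  have h2 := hκ r ⟨hr0.le, hrρ⟩
  have h3 := hN₁ N (le_trans (le_max_left _ _) hN)
  rw [hz, zero_sub, abs_neg] at h1
  have := le_abs_self (kneadingTail (kneadingSign f₀ c₀) 0 r)
  linarith

theorem exists_abs_entropyOn_sub_le_of_pos (hf₀ : IsUnimodalMax f₀ c₀)
    (h₀ : 0 < entropyOn f₀ (Icc (-1 : ℝ) 1)) :
    ∃ C > 0, ∃ N₀ : ℕ, ∀ N ≥ N₀, ∀ f c, IsUnimodalMax f c →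
      (∀ n ≤ N, kneadingSign f c n = kneadingSign f₀ c₀ n) →
        |entropyOn f (Icc (-1 : ℝ) 1) - entropyOn f₀ (Icc (-1 : ℝ) 1)| ≤
          Real.exp (-(C * N)) := by
  have hθ₀ := kneadingSign_eq f₀ c₀
  have hz₀ := hf₀.kneadingTail_exp_neg_eq_zero h₀
  have hr₀ := Real.exp_pos (-entropyOn f₀ (Icc (-1 : ℝ) 1))
  have hr₀1 : Real.exp (-entropyOn f₀ (Icc (-1 : ℝ) 1)) < 1 := by
    rw [Real.exp_lt_one_iff]; linarith
  have hpos : ∀ z, 0 ≤ z → z < Real.exp (-entropyOn f₀ (Icc (-1 : ℝ) 1)) →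
      0 < kneadingTail (kneadingSign f₀ c₀) 0 z := by
    intro z hz0 hz
    rcases hz0.eq_or_lt with h | h
    · rw [← h, kneadingTail_zero]; exact one_pos
    · exact hf₀.kneadingTail_pos h hz 0
  obtain ⟨ρ, κ, m, hrρ, hρ1, hκ0, hm, hκ⟩ := exists_pow_le_abs_of_analytic
    (analyticOnNhd_kneadingTail hθ₀ 0) hr₀ hr₀1 hpos hz₀
  have hlog₀ : entropyOn f₀ (Icc (-1 : ℝ) 1) =
      -Real.log (Real.exp (-entropyOn f₀ (Icc (-1 : ℝ) 1))) := by rw [Real.log_exp]; ring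
  have hthird : ∀ f c, IsUnimodalMax f c → 1 / 3 ≤ Real.exp (-entropyOn f (Icc (-1 : ℝ) 1)) := by
    intro f c hf
    have := Real.exp_le_exp.2 (neg_le_neg hf.entropyOn_le_log_three)
    rwa [Real.exp_neg, Real.exp_log (by norm_num), ← one_div] at this
  have hthird₀ := hthird f₀ c₀ hf₀
  have hanti₀ := hf₀.entropyOn_nonneg
  set r₀ := Real.exp (-entropyOn f₀ (Icc (-1 : ℝ) 1)) with hr₀def
  set D₀ := kneadingTail (kneadingSign f₀ c₀) 0
  have hρ0 : 0 < ρ := hr₀.trans hrρ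
  have h1ρ : 0 < 1 - ρ := by linarith
  set B : ℝ := 2 / (1 - ρ) * (1 + 1 / (1 - ρ)) with hB
  have hB0 : 0 < B := by positivity
  have hlim : Tendsto (fun N : ℕ => B * ρ ^ N) atTop (nhds 0) := by
    simpa using (tendsto_pow_atTop_nhds_zero_of_lt_one hρ0.le hρ1).const_mul B
  obtain ⟨N₁, hN₁⟩ := eventually_atTop.1
    (hlim.eventually (gt_mem_nhds (show 0 < κ * (ρ - r₀) ^ m by
      have : 0 < ρ - r₀ := by linarith
      positivity)))
  obtain ⟨C, hC, N₂, hN₂⟩ := exists_mul_pow_le_exp (A := 3 ^ m * (B / κ)) hρ0 hρ1 hm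
  refine ⟨C, hC, max N₁ N₂, fun N hN f c hf hagree => ?_⟩
  have hθ := kneadingSign_eq f c
  have hclose : ∀ z, 0 ≤ z → z ≤ ρ →
      |kneadingTail (kneadingSign f c) 0 z - D₀ z| ≤ 2 / (1 - ρ) * ρ ^ N := fun z hz0 hzρ =>
    abs_kneadingTail_sub_le hθ hθ₀ hagree hz0 hzρ hρ1
  have hlog : entropyOn f (Icc (-1 : ℝ) 1) =
      -Real.log (Real.exp (-entropyOn f (Icc (-1 : ℝ) 1))) := by rw [Real.log_exp]; ring
  have hthird' := hthird f c hf
  have hr0 := Real.exp_pos (-entropyOn f (Icc (-1 : ℝ) 1))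
  have hposr : Real.exp (-entropyOn f (Icc (-1 : ℝ) 1)) < 1 →
      kneadingTail (kneadingSign f c) 0 (Real.exp (-entropyOn f (Icc (-1 : ℝ) 1))) = 0 := by
    intro h
    rw [Real.exp_lt_one_iff] at h
    exact hf.kneadingTail_exp_neg_eq_zero (by linarith)
  have hanti := fun x y (hx : 0 < x) (hxy : x ≤ y) hy =>
    hf.kneadingTail_mul_one_sub_anti (x := x) (y := y) hx hxy hy
  have hDpos := fun x (hx : 0 < x) hy => hf.kneadingTail_pos (z := x) hx hy 0
  set r := Real.exp (-entropyOn f (Icc (-1 : ℝ) 1))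
  set D := kneadingTail (kneadingSign f c) 0
  set ω := 2 / (1 - ρ) * ρ ^ N with hω
  have hω0 : 0 < ω := by positivity
  have hBω : B * ρ ^ N = ω * (1 + 1 / (1 - ρ)) := by rw [hB, hω]; ring
  have hωB : ω ≤ B * ρ ^ N := by
    rw [hBω]
    have : 0 < 1 / (1 - ρ) := by positivity
    nlinarith
  have hright : ∀ x, r₀ ≤ x → x < r → x ≤ ρ → κ * (x - r₀) ^ m ≤ B * ρ ^ N := by
    intro x hx hxr hxρ
    have h1 := hκ x (hr₀.le.trans hx) hxρ
    rw [abs_of_nonneg (by linarith : 0 ≤ x - r₀)] at h1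
    refine h1.trans ?_
    have h2 := hanti r₀ x hr₀ hx hxr
    have h3 := hclose r₀ hr₀.le hrρ.le
    have h4 := hclose x (hr₀.le.trans hx) hxρ
    have h5 := hDpos x (hr₀.trans_le hx) hxr
    have h6 := hDpos r₀ hr₀ (hx.trans_lt hxr)
    rw [hz₀, sub_zero, abs_of_pos h6] at h3
    have h7 : D x ≤ ω / (1 - ρ) := by
      rw [le_div_iff₀ h1ρ]
      nlinarith
    have h8 : |D₀ x| ≤ |D x| + ω := by
      have := abs_sub_abs_le_abs_sub (D₀ x) (D x)
      rw [abs_sub_comm] at this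
      linarith
    rw [abs_of_pos h5] at h8
    rw [hBω]
    have : ω * (1 + 1 / (1 - ρ)) = ω + ω / (1 - ρ) := by ring
    linarith
  have hmain : κ * |r - r₀| ^ m ≤ B * ρ ^ N := by
    rcases le_or_gt r r₀ with h | h
    · have hrρ' : r ≤ ρ := h.trans hrρ.le
      have h1 := hκ r hr0.le hrρ'
      have h2 := hclose r hr0.le hrρ'
      rw [hposr (h.trans_lt hr₀1), zero_sub, abs_neg] at h2
      linarith
    · have hlt : r < ρ := by
        by_contra hcon
        push Not at hcon
        have hc : ContinuousAt (fun x => κ * (x - r₀) ^ m) ρ := by fun_prop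
        have := le_of_tendsto (hc.tendsto.mono_left (nhdsWithin_le_nhds (s := Iio ρ)))
          (by
            filter_upwards [Ioo_mem_nhdsLT hrρ] with x hx
            exact hright x hx.1.le (hx.2.trans_le hcon) hx.2.le)
        have := hN₁ N (le_trans (le_max_left _ _) hN)
        linarith
      have hc : ContinuousAt (fun x => κ * (x - r₀) ^ m) r := by fun_prop
      rw [abs_of_pos (by linarith : 0 < r - r₀)]
      refine le_of_tendsto (hc.tendsto.mono_left (nhdsWithin_le_nhds (s := Iio r))) ?_
      filter_upwards [Ioo_mem_nhdsLT h] with x hx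
      exact hright x hx.1.le hx.2 (hx.2.trans hlt).le
  have hlogdiff : |entropyOn f (Icc (-1 : ℝ) 1) - entropyOn f₀ (Icc (-1 : ℝ) 1)| ≤
      3 * |r - r₀| := by
    have hgen : ∀ a b : ℝ, 1 / 3 ≤ a → 1 / 3 ≤ b → Real.log a - Real.log b ≤ 3 * |b - a| := by
      intro a b ha hb
      have ha0 : 0 < a := by linarith
      have hb0 : 0 < b := by linarith
      rw [← Real.log_div ha0.ne' hb0.ne']
      refine (Real.log_le_sub_one_of_pos (by positivity)).trans ?_
      have : a / b - 1 = (a - b) / b := by field_simp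
      rw [this, div_le_iff₀ hb0]
      have h1 := neg_abs_le (b - a)
      have h2 := abs_nonneg (b - a)
      nlinarith
    rw [hlog, hlog₀, abs_le]
    have h1 := hgen r r₀ hthird' hthird₀
    have h2 := hgen r₀ r hthird₀ hthird'
    rw [abs_sub_comm] at h1
    constructor <;> linarith
  refine hlogdiff.trans (hN₂ N (le_trans (le_max_right _ _) hN) _ ?_)
  rw [mul_pow, mul_assoc]
  gcongr
  rw [div_mul_eq_mul_div, le_div_iff₀ hκ0]
  linarith

/-- Maps whose kneading signs agree with those of `f₀` up to time `N` have exponentially close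
entropy, as soon as the kneading signs of `f₀` are not those of the Feigenbaum map. -/
theorem exists_abs_entropyOn_sub_le (hf₀ : IsUnimodalMax f₀ c₀)
    (hTM : ∃ n, ¬ (kneadingSign f₀ c₀ (2 * n) = kneadingSign f₀ c₀ n ∧
      kneadingSign f₀ c₀ (2 * n + 1) = -kneadingSign f₀ c₀ n)) :
    ∃ C > 0, ∃ N₀ : ℕ, ∀ N ≥ N₀, ∀ f c, IsUnimodalMax f c →
      (∀ n ≤ N, kneadingSign f c n = kneadingSign f₀ c₀ n) →
        |entropyOn f (Icc (-1 : ℝ) 1) - entropyOn f₀ (Icc (-1 : ℝ) 1)| ≤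
          Real.exp (-(C * N)) := by
  rcases hf₀.entropyOn_nonneg.eq_or_lt with h | h
  · obtain ⟨N₀, hN₀⟩ := hf₀.exists_entropyOn_eq_zero h.symm hTM
    refine ⟨1, one_pos, N₀, fun N hN f c hf hagree => ?_⟩
    rw [hN₀ N hN f c hf hagree, ← h, sub_zero, abs_zero]
    exact (Real.exp_pos _).le
  · exact hf₀.exists_abs_entropyOn_sub_le_of_pos h

end IsUnimodalMax

theorem kneadingSign_succ_of_ne {f : ℝ → ℝ} {c : ℝ} {n : ℕ} (h : f^[n + 1] c ≠ c) :
    kneadingSign f c (n + 1) =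
      if f^[n + 1] c < c then kneadingSign f c n else -kneadingSign f c n := by
  rw [kneadingSign, if_neg h]

theorem kneadingSign_congr {f f₀ : ℝ → ℝ} {c c₀ : ℝ} {N : ℕ}
    (h : ∀ n, 1 ≤ n → n ≤ N →
      f^[n] c ≠ c ∧ f₀^[n] c₀ ≠ c₀ ∧ (f^[n] c < c ↔ f₀^[n] c₀ < c₀)) :
    ∀ n ≤ N, kneadingSign f c n = kneadingSign f₀ c₀ n := by
  intro n
  induction n with
  | zero => intro _; rw [kneadingSign, kneadingSign]
  | succ n ih =>
    intro hn
    obtain ⟨h1, h2, h3⟩ := h (n + 1) (by omega) hn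
    rw [kneadingSign_succ_of_ne h1, kneadingSign_succ_of_ne h2, ih (by omega)]
    simp only [h3]

/-- If the critical orbit eventually follows a periodic pattern of sides of the turning point,
then the kneading signs do not satisfy the period doubling rule. -/
theorem exists_not_doubling {f : ℝ → ℝ} {c : ℝ} {M K : ℕ} (hK : 0 < K)
    (hne : ∀ n, 1 ≤ n → f^[n] c ≠ c)
    (hper : ∀ n ≥ M, (f^[n + K] c < c ↔ f^[n] c < c)) :
    ∃ n, ¬ (kneadingSign f c (2 * n) = kneadingSign f c n ∧
      kneadingSign f c (2 * n + 1) = -kneadingSign f c n) := by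
  by_contra! hd
  have hθ := kneadingSign_eq f c
  have hconst : ∀ i, kneadingSign f c (M + i + K) * kneadingSign f c (M + i) =
      kneadingSign f c (M + K) * kneadingSign f c M := by
    intro i
    induction i with
    | zero => rfl
    | succ i ih =>
      have h1 := hper (M + i + 1) (by omega)
      rw [show M + i + 1 + K = M + i + K + 1 by ring] at h1
      rw [show M + (i + 1) + K = M + i + K + 1 by ring, show M + (i + 1) = M + i + 1 by ring,
        kneadingSign_succ_of_ne (hne _ (by omega)), kneadingSign_succ_of_ne (hne _ (by omega)),
        ← ih]
      by_cases h2 : f^[M + i + 1] c < c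
      · rw [if_pos h2, if_pos (h1.2 h2)]
      · rw [if_neg h2, if_neg (mt h1.1 h2)]
        ring
  refine not_periodic_of_doubling hθ hd M (2 * K) (by omega) fun n hn => ?_
  obtain ⟨i, rfl⟩ := Nat.exists_eq_add_of_le hn
  have h1 := hconst i
  have h2 := hconst (i + K)
  rw [← h1, show M + (i + K) + K = M + i + 2 * K by ring,
    show M + (i + K) = M + i + K by ring] at h2
  rcases hθ (M + i + 2 * K) with a | a <;> rcases hθ (M + i + K) with b | b <;>
    rcases hθ (M + i) with d | d <;> rw [a, b, d] at h2 <;> rw [a, d] <;> norm_num at h2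

/-- A uniform estimate for the iterates of a Lipschitz family, compared with those at `t = 0`. -/
theorem exists_abs_iterate_sub_le {G : ℝ → ℝ → ℝ}
    (hC2 : ContDiffOn ℝ 2 (fun q : ℝ × ℝ => G q.1 q.2) (Icc (-1 : ℝ) 1 ×ˢ Icc (0 : ℝ) 1))
    (hmaps : ∀ t ∈ Icc (0 : ℝ) 1, MapsTo (fun x => G x t) (Icc (-1 : ℝ) 1) (Icc (-1 : ℝ) 1))
    (j : ℕ) :
    ∃ C > 0, ∀ t ∈ Icc (0 : ℝ) 1, ∀ x ∈ Icc (-1 : ℝ) 1, ∀ y ∈ Icc (-1 : ℝ) 1,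
      |(fun x => G x t)^[j] x - (fun x => G x 0)^[j] y| ≤ C * (|x - y| + t) := by
  obtain ⟨L, hL⟩ := hC2.exists_lipschitzOnWith (by norm_num)
    ((convex_Icc _ _).prod (convex_Icc _ _)) (isCompact_Icc.prod isCompact_Icc)
  have hstep : ∀ t ∈ Icc (0 : ℝ) 1, ∀ x ∈ Icc (-1 : ℝ) 1, ∀ y ∈ Icc (-1 : ℝ) 1,
      |G x t - G y 0| ≤ L * (|x - y| + t) := by
    intro t ht x hx y hy
    have h := hL.dist_le_mul (x, t) ⟨hx, ht⟩ (y, 0) ⟨hy, le_rfl, zero_le_one⟩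
    rw [Real.dist_eq, Prod.dist_eq, Real.dist_eq, Real.dist_eq, sub_zero, abs_of_nonneg ht.1] at h
    refine h.trans ?_
    gcongr
    exact max_le (le_add_of_nonneg_right ht.1) (le_add_of_nonneg_left (abs_nonneg _))
  induction j with
  | zero =>
    refine ⟨1, one_pos, fun t ht x _ y _ => ?_⟩
    rw [one_mul]
    exact le_add_of_nonneg_right ht.1
  | succ j ih =>
    obtain ⟨C, hC, h⟩ := ih
    refine ⟨L * (C + 1) + 1, by positivity, fun t ht x hx y hy => ?_⟩
    rw [Function.iterate_succ_apply', Function.iterate_succ_apply']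
    have h0 : (0 : ℝ) ∈ Icc (0 : ℝ) 1 := ⟨le_rfl, zero_le_one⟩
    refine (hstep t ht _ ((hmaps t ht).iterate j hx) _ ((hmaps 0 h0).iterate j hy)).trans ?_
    have h1 := h t ht x hx y hy
    have h2 := abs_nonneg (x - y)
    have h3 := ht.1
    calc (L : ℝ) * (|(fun x => G x t)^[j] x - (fun x => G x 0)^[j] y| + t)
        ≤ L * (C * (|x - y| + t) + (|x - y| + t)) := by gcongr; linarith
      _ ≤ (L * (C + 1) + 1) * (|x - y| + t) := by nlinarith

theorem ContDiffOn.iterate_of_mapsTo {f : ℝ → ℝ} {s : Set ℝ} (hf : ContDiffOn ℝ 2 f s)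
    (hs : MapsTo f s s) (n : ℕ) : ContDiffOn ℝ 2 f^[n] s := by
  induction n with
  | zero => exact contDiffOn_id
  | succ n ih =>
    rw [Function.iterate_succ']
    exact hf.comp ih (hs.iterate n)

/-- Second order estimate for the displacement of a `C²` map at a point of multiplier one. -/
theorem exists_abs_displacement_sub_le {F : ℝ → ℝ} (hF : ContDiffOn ℝ 2 F (Icc (-1 : ℝ) 1))
    {p : ℝ} (hp : p ∈ Icc (-1 : ℝ) 1) (hd : HasDerivAt F 1 p) :
    ∃ C > 0, ∀ r, 0 ≤ r → ∀ x ∈ Icc (-1 : ℝ) 1, ∀ y ∈ Icc (-1 : ℝ) 1, |x - p| ≤ r → |y - p| ≤ r →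
      |(F y - y) - (F x - x)| ≤ C * r * |y - x| := by
  have hu : UniqueDiffOn ℝ (Icc (-1 : ℝ) 1) := uniqueDiffOn_Icc (by norm_num)
  have h1 : ContDiffOn ℝ 1 (derivWithin F (Icc (-1 : ℝ) 1)) (Icc (-1 : ℝ) 1) :=
    hF.derivWithin hu (by norm_num)
  obtain ⟨L, hL⟩ := h1.exists_lipschitzOnWith (by norm_num) (convex_Icc _ _) isCompact_Icc
  have hdp : derivWithin F (Icc (-1 : ℝ) 1) p = 1 := hd.hasDerivWithinAt.derivWithin (hu p hp)
  refine ⟨L + 1, by positivity, fun r hr x hx y hy hxr hyr => ?_⟩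
  have hsub : Icc (-1 : ℝ) 1 ∩ Metric.closedBall p r ⊆ Icc (-1 : ℝ) 1 := inter_subset_left
  have h2 := Convex.norm_image_sub_le_of_norm_hasDerivWithin_le
    (f := fun x => F x - x) (f' := fun x => derivWithin F (Icc (-1 : ℝ) 1) x - 1)
    (s := Icc (-1 : ℝ) 1 ∩ Metric.closedBall p r) (C := L * r) (x := x) (y := y)
    (fun z hz => (((hF.differentiableOn (by norm_num)) z hz.1).hasDerivWithinAt.sub
      (hasDerivWithinAt_id z _)).mono hsub)
    (fun z hz => by
      have h3 := hL.dist_le_mul z hz.1 p hp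
      rw [hdp] at h3
      refine h3.trans ?_
      gcongr
      exact hz.2)
    ((convex_Icc _ _).inter (convex_closedBall _ _)) ⟨hx, hxr⟩ ⟨hy, hyr⟩
  rw [Real.norm_eq_abs, Real.norm_eq_abs] at h2
  refine h2.trans ?_
  gcongr
  linarith

/-- Turning points depend continuously on the parameter at `t = 0`. -/
theorem exists_abs_turning_sub_lt {G : ℝ → ℝ → ℝ}
    (hcont : ∃ C > 0, ∀ t ∈ Icc (0 : ℝ) 1, ∀ x ∈ Icc (-1 : ℝ) 1, |G x t - G x 0| ≤ C * t)
    {c : ℝ} (hc : C2UnimodalWith (fun x => G x 0) c) {ε : ℝ} (hε : 0 < ε) :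
    ∃ δ, 0 < δ ∧ δ ≤ 1 ∧ ∀ t ∈ Icc 0 δ, ∀ ct, C2UnimodalWith (fun x => G x t) ct →
      |ct - c| < ε := by
  obtain ⟨C, hC, hG⟩ := hcont
  obtain ⟨hcI, -, -, -, -, -, hshape⟩ := hc
  obtain ⟨e, he0, heε, he1, he2⟩ : ∃ e, 0 < e ∧ e < ε ∧ -1 < c - e ∧ c + e < 1 := by
    refine ⟨min (ε / 2) (min ((c + 1) / 2) ((1 - c) / 2)), ?_, ?_, ?_, ?_⟩
    · have := hcI.1; have := hcI.2
      refine lt_min (by linarith) (lt_min ?_ ?_) <;> linarith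
    · exact (min_le_left _ _).trans_lt (by linarith)
    · have := (min_le_right (ε / 2) (min ((c + 1) / 2) ((1 - c) / 2))).trans (min_le_left _ _)
      have := hcI.1
      linarith
    · have := (min_le_right (ε / 2) (min ((c + 1) / 2) ((1 - c) / 2))).trans (min_le_right _ _)
      have := hcI.2
      linarith
  have hx1 : c - e ∈ Icc (-1 : ℝ) 1 := ⟨by linarith, by linarith⟩
  have hx2 : c ∈ Icc (-1 : ℝ) 1 := ⟨by linarith, by linarith⟩
  have hx3 : c + e ∈ Icc (-1 : ℝ) 1 := ⟨by linarith, by linarith⟩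
  have hm1 : c - e ∈ Icc (-1 : ℝ) c := ⟨by linarith, by linarith⟩
  have hm2 : c ∈ Icc (-1 : ℝ) c := ⟨by linarith, by linarith⟩
  have hm3 : c ∈ Icc c 1 := ⟨by linarith, by linarith⟩
  have hm4 : c + e ∈ Icc c 1 := ⟨by linarith, by linarith⟩
  obtain ⟨η, hη, hsep⟩ : ∃ η > 0,
      (G (c - e) 0 + η < G c 0 ∧ G (c + e) 0 + η < G c 0) ∨
      (G c 0 + η < G (c - e) 0 ∧ G c 0 + η < G (c + e) 0) := by
    rcases hshape with ⟨h1, h2⟩ | ⟨h1, h2⟩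
    · have h3 := h1 hm1 hm2 (by linarith)
      have h4 := h2 hm3 hm4 (by linarith)
      simp only at h3 h4
      refine ⟨min (G c 0 - G (c - e) 0) (G c 0 - G (c + e) 0) / 2,
        half_pos (lt_min (by linarith) (by linarith)), Or.inl ?_⟩
      have h5 := min_le_left (G c 0 - G (c - e) 0) (G c 0 - G (c + e) 0)
      have h6 := min_le_right (G c 0 - G (c - e) 0) (G c 0 - G (c + e) 0)
      constructor <;> linarith
    · have h3 := h1 hm1 hm2 (by linarith)
      have h4 := h2 hm3 hm4 (by linarith)
      simp only at h3 h4
      refine ⟨min (G (c - e) 0 - G c 0) (G (c + e) 0 - G c 0) / 2,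
        half_pos (lt_min (by linarith) (by linarith)), Or.inr ?_⟩
      have h5 := min_le_left (G (c - e) 0 - G c 0) (G (c + e) 0 - G c 0)
      have h6 := min_le_right (G (c - e) 0 - G c 0) (G (c + e) 0 - G c 0)
      constructor <;> linarith
  refine ⟨min 1 (η / (2 * C)), lt_min one_pos (by positivity), min_le_left _ _,
    fun t ht ct hct => ?_⟩
  have ht1 : t ∈ Icc (0 : ℝ) 1 := ⟨ht.1, ht.2.trans (min_le_left _ _)⟩
  have ht2 : C * t ≤ η / 2 := by
    have := ht.2.trans (min_le_right _ _)
    rw [le_div_iff₀ (by positivity)] at this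
    linarith
  have h1 := abs_le.1 (hG t ht1 _ hx1)
  have h2 := abs_le.1 (hG t ht1 _ hx2)
  have h3 := abs_le.1 (hG t ht1 _ hx3)
  obtain ⟨hctI, -, -, -, -, -, hshape'⟩ := hct
  by_contra hcon
  push Not at hcon
  rcases le_abs.1 hcon with h | h
  · have a1 : c - e ∈ Icc (-1 : ℝ) ct := ⟨hx1.1, by linarith⟩
    have a2 : c ∈ Icc (-1 : ℝ) ct := ⟨hx2.1, by linarith⟩
    have a3 : c + e ∈ Icc (-1 : ℝ) ct := ⟨hx3.1, by linarith⟩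
    rcases hshape' with ⟨hs, -⟩ | ⟨hs, -⟩
    · have b1 := hs a1 a2 (by linarith)
      have b2 := hs a2 a3 (by linarith)
      simp only at b1 b2
      rcases hsep with ⟨s1, s2⟩ | ⟨s1, s2⟩ <;> linarith
    · have b1 := hs a1 a2 (by linarith)
      have b2 := hs a2 a3 (by linarith)
      simp only at b1 b2
      rcases hsep with ⟨s1, s2⟩ | ⟨s1, s2⟩ <;> linarith
  · have a1 : c - e ∈ Icc ct 1 := ⟨by linarith, hx1.2⟩
    have a2 : c ∈ Icc ct 1 := ⟨by linarith, hx2.2⟩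
    have a3 : c + e ∈ Icc ct 1 := ⟨by linarith, hx3.2⟩
    rcases hshape' with ⟨-, hs⟩ | ⟨-, hs⟩
    · have b1 := hs a1 a2 (by linarith)
      have b2 := hs a2 a3 (by linarith)
      simp only at b1 b2
      rcases hsep with ⟨s1, s2⟩ | ⟨s1, s2⟩ <;> linarith
    · have b1 := hs a1 a2 (by linarith)
      have b2 := hs a2 a3 (by linarith)
      simp only at b1 b2
      rcases hsep with ⟨s1, s2⟩ | ⟨s1, s2⟩ <;> linarith

theorem neg_conj_iterate (f : ℝ → ℝ) (n : ℕ) (x : ℝ) :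
    (fun y => -f (-y))^[n] x = -f^[n] (-x) := by
  induction n generalizing x with
  | zero => simp
  | succ n ih => rw [Function.iterate_succ_apply, ih, Function.iterate_succ_apply, neg_neg]

/-- Orbits of a perturbation of size `O(t)` need a time of order `t^(-1/2)` to escape from the
attracting side of a neutral fixed point. -/
theorem iterate_sub_mem_Icc {F H : ℝ → ℝ} {S : Set ℝ} {p z w C t : ℝ} (hC : 0 < C)
    (hF : ∀ r, 0 ≤ r → ∀ x ∈ S, ∀ y ∈ S, |x - p| ≤ r → |y - p| ≤ r →
      |(F y - y) - (F x - x)| ≤ C * r * |y - x|)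
    (hp : p ∈ S) (hFp : F p = p) (ht : 0 ≤ t) (hH : ∀ x ∈ S, |H x - F x| ≤ C * t)
    (hmaps : MapsTo H S S) (hz : z ∈ S) (hpz : p < z) (hCz : C * (z - p) ≤ 1 / 2)
    (hFz : F z ≤ z - C * t) (htz : Real.sqrt t ≤ z - p) (hw : w ∈ S) (hpw : p ≤ w) (hwz : w ≤ z)
    (n : ℕ) (hn : 2 * C * n * Real.sqrt t ≤ 1) :
    -(2 * C * n * t) ≤ H^[n] w - p ∧ H^[n] w ≤ z := by
  have hs := Real.sqrt_nonneg t
  have hst := Real.mul_self_sqrt ht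
  induction n with
  | zero => simpa using ⟨hpw, hwz⟩
  | succ n ih =>
    have hn' : 2 * C * n * Real.sqrt t ≤ 1 := by
      refine le_trans ?_ hn
      gcongr
      exact n.le_succ
    obtain ⟨h1, h2⟩ := ih hn'
    rw [Function.iterate_succ_apply']
    have hx : H^[n] w ∈ S := hmaps.iterate n hw
    set x := H^[n] w
    have h3 := abs_le.1 (hH x hx)
    have h4 : 2 * C * n * t ≤ Real.sqrt t := by
      have := mul_le_mul_of_nonneg_right hn' hs
      rwa [mul_assoc _ (Real.sqrt t), hst, one_mul] at this
    have h5 : |x - p| ≤ z - p := by rw [abs_le]; constructor <;> linarith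
    have h6 : |z - p| ≤ z - p := by rw [abs_le]; constructor <;> linarith
    constructor
    · push_cast
      rcases le_or_gt p x with hpx | hpx
      · have h7 := abs_le.1 (hF (z - p) (by linarith) p hp x hx (by simp; linarith) h5)
        rw [abs_of_nonneg (by linarith : 0 ≤ x - p), hFp] at h7
        have h8 : 0 ≤ 2 * C * n * t := by positivity
        nlinarith
      · have habs : |x - p| = p - x := by rw [abs_of_neg (by linarith)]; ring
        have h7 := abs_le.1 (hF (p - x) (by linarith) p hp x hx (by simp; linarith) habs.le)
        rw [habs, hFp] at h7
        have h8 : (p - x) * (p - x) ≤ t := by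
          rw [← hst]
          apply mul_self_le_mul_self <;> linarith
        nlinarith
    · have h7 := abs_le.1 (hF (z - p) (by linarith) x hx z hz h5 h6)
      rw [abs_of_nonneg (by linarith : 0 ≤ z - x)] at h7
      nlinarith

/-- The two-sided version of `iterate_sub_mem_Icc`: the orbit stays close to the fixed point. -/
theorem abs_iterate_sub_le {F H : ℝ → ℝ} {S : Set ℝ} {p z w C t : ℝ} (hC : 0 < C)
    (hF : ∀ r, 0 ≤ r → ∀ x ∈ S, ∀ y ∈ S, |x - p| ≤ r → |y - p| ≤ r →
      |(F y - y) - (F x - x)| ≤ C * r * |y - x|)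
    (hp : p ∈ S) (hFp : F p = p) (ht : 0 ≤ t) (hH : ∀ x ∈ S, |H x - F x| ≤ C * t)
    (hmaps : MapsTo H S S) (hz : z ∈ S) (hpz : z ≠ p) (hCz : C * |z - p| ≤ 1 / 2)
    (hpw : 0 ≤ (w - p) * (z - p))
    (hFz : 0 ≤ (F z - p) * (z - p)) (hFz' : |F z - p| ≤ |z - p| - C * t)
    (htz : Real.sqrt t ≤ |z - p|) (hw : w ∈ S) (hwz : |w - p| ≤ |z - p|)
    (n : ℕ) (hn : 2 * C * n * Real.sqrt t ≤ 1) :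
    |H^[n] w - p| ≤ |z - p| := by
  have h4 : 2 * C * n * t ≤ Real.sqrt t := by
    have := mul_le_mul_of_nonneg_right hn (Real.sqrt_nonneg t)
    rwa [mul_assoc _ (Real.sqrt t), Real.mul_self_sqrt ht, one_mul] at this
  rcases lt_or_gt_of_ne hpz with h | h
  · have hzp : |z - p| = p - z := by rw [abs_of_neg (by linarith)]; ring
    rw [hzp] at hCz hFz' htz hwz ⊢
    have hwp : w ≤ p := by by_contra! hcon; nlinarith
    have hFp' : F z ≤ p := by by_contra! hcon; nlinarith
    have h1 := abs_le.1 hwz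
    have h2 := abs_le.1 hFz'
    have key := iterate_sub_mem_Icc (F := fun y => -F (-y)) (H := fun y => -H (-y)) (S := -S)
      (p := -p) (z := -z) (w := -w) (t := t) hC
      (fun r hr x hx y hy hxr hyr => by
        have := hF r hr (-x) hx (-y) hy (by rw [← abs_neg]; convert hxr using 2; ring)
          (by rw [← abs_neg]; convert hyr using 2; ring)
        rw [← abs_neg, ← abs_neg (-y - -x)] at this
        convert this using 2
        · ring
        · ring_nf)
      (by simpa using hp) (by simpa using hFp) ht
      (fun x hx => by
        have := hH (-x) hx
        rw [← abs_neg] at this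
        convert this using 2
        ring)
      (fun x hx => by simpa using hmaps hx) (by simpa using hz) (by linarith) (by linarith)
      (by simp only [neg_neg]; linarith) (by linarith) (by simpa using hw) (by linarith)
      (by linarith) n hn
    rw [neg_conj_iterate, neg_neg] at key
    rw [abs_le]
    constructor <;> linarith [key.1, key.2]
  · have hzp : |z - p| = z - p := abs_of_pos (by linarith)
    rw [hzp] at hCz hFz' htz hwz ⊢
    have hwp : p ≤ w := by by_contra! hcon; nlinarith
    have h1 := abs_le.1 hwz
    have h2 := abs_le.1 hFz'
    have key := iterate_sub_mem_Icc hC hF hp hFp ht hH hmaps hz h hCz (by linarith) htz hw hwp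
      (by linarith) n hn
    rw [abs_le]
    constructor <;> linarith [key.1, key.2]

/-- An orbit converging to a neutral fixed point eventually stays on one side of it, and gets
strictly closer to it at arbitrarily small distances. -/
theorem exists_abs_displaced_lt {F : ℝ → ℝ} {S : Set ℝ} {p y C : ℝ} (hC : 0 < C)
    (hF : ∀ r, 0 ≤ r → ∀ x ∈ S, ∀ y ∈ S, |x - p| ≤ r → |y - p| ≤ r →
      |(F y - y) - (F x - x)| ≤ C * r * |y - x|)
    (hp : p ∈ S) (hFp : F p = p) (hmaps : MapsTo F S S) (hy : y ∈ S)
    (hlim : Tendsto (fun n => F^[n] y) atTop (nhds p)) (hne : ∀ n, F^[n] y ≠ p)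
    {δ : ℝ} (hδ : 0 < δ) :
    ∃ n, |F^[n] y - p| ≤ δ ∧ C * |F^[n] y - p| ≤ 1 / 2 ∧ |F^[n + 1] y - p| < |F^[n] y - p| ∧
      0 < (F^[n + 1] y - p) * (F^[n] y - p) := by
  have hlim' : Tendsto (fun n => |F^[n] y - p|) atTop (nhds 0) := by
    have := (hlim.sub_const p).abs
    simpa using this
  obtain ⟨n₀, hn₀⟩ := eventually_atTop.1
    (hlim'.eventually (ge_mem_nhds (show 0 < min δ (1 / 2 / C) by positivity)))
  obtain ⟨n, hn, hlt⟩ : ∃ n ≥ n₀, |F^[n + 1] y - p| < |F^[n] y - p| := by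
    by_contra! hcon
    have hge : ∀ i, |F^[n₀] y - p| ≤ |F^[n₀ + i] y - p| := by
      intro i
      induction i with
      | zero => rfl
      | succ i ih => exact ih.trans (hcon _ (by omega))
    have h1 : 0 < |F^[n₀] y - p| := abs_pos.2 (sub_ne_zero.2 (hne n₀))
    have h2 : Tendsto (fun i => |F^[n₀ + i] y - p|) atTop (nhds 0) := by
      simpa only [add_comm] using (tendsto_add_atTop_iff_nat n₀).2 hlim'
    exact absurd (ge_of_tendsto' h2 hge) (not_le.2 h1)
  have h1 := hn₀ n hn
  have h2 : C * |F^[n] y - p| ≤ 1 / 2 := by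
    have := h1.trans (min_le_right _ _)
    rw [le_div_iff₀ hC] at this
    linarith
  refine ⟨n, h1.trans (min_le_left _ _), h2, hlt, ?_⟩
  have h3 := hF _ (abs_nonneg _) p hp _ (hmaps.iterate n hy) (by simp) le_rfl
  rw [hFp, sub_self, sub_zero, ← Function.iterate_succ_apply' F] at h3
  have h4 : 0 < |F^[n] y - p| := abs_pos.2 (sub_ne_zero.2 (hne n))
  have h5 : |F^[n + 1] y - F^[n] y| ≤ 1 / 2 * |F^[n] y - p| := h3.trans (by gcongr)
  have h6 := abs_le.1 h5
  rcases abs_cases (F^[n] y - p) with ⟨h7, h8⟩ | ⟨h7, h8⟩ <;> rw [h7] at h6 h4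
  · exact mul_pos (by linarith) h4
  · exact mul_pos_of_neg_of_neg (by linarith) (by linarith)

/-- An orbit attracted by a periodic orbit converges, along the period, to one of its points. -/
theorem exists_tendsto_iterate_of_infDist {g : ℝ → ℝ} {I : Set ℝ} (hcont : ContinuousOn g I)
    (hmaps : MapsTo g I I) {p c : ℝ} (hp : p ∈ I) (hc : c ∈ I) {k : ℕ} (hk : 1 ≤ k)
    (hper : g^[k] p = p)
    (hattract : Tendsto (fun n : ℕ => Metric.infDist (g^[n] c) {y : ℝ | ∃ i < k, g^[i] p = y})
      atTop (nhds 0)) :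
    ∃ M, Tendsto (fun n => g^[k * n] (g^[M] c)) atTop (nhds p) := by
  set O : Set ℝ := {y : ℝ | ∃ i < k, g^[i] p = y} with hO
  have hfin : O.Finite := by
    have : O = (fun i => g^[i] p) '' Iio k := by
      ext y; simp [hO, mem_image]
    rw [this]
    exact (finite_Iio k).image _
  have hne : O.Nonempty := ⟨p, 0, hk, rfl⟩
  have hOI : ∀ q ∈ O, q ∈ I := by rintro q ⟨i, -, rfl⟩; exact hmaps.iterate i hp
  have hOfix : ∀ q ∈ O, g^[k] q = q := by
    rintro q ⟨i, -, rfl⟩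
    rw [← Function.iterate_add_apply, add_comm, Function.iterate_add_apply, hper]
  have hcontk : ∀ n, ContinuousOn g^[n] I := fun n => hcont.iterate hmaps n
  obtain ⟨d, hd, hdist⟩ : ∃ d > 0, ∀ x ∈ O, ∀ y ∈ O, x ≠ y → d ≤ dist x y := by
    rcases O.subsingleton_or_nontrivial with h | h
    · exact ⟨1, one_pos, fun x hx y hy hxy => (hxy (h hx hy)).elim⟩
    · exact ⟨O.infsep, hfin.infsep_pos_iff_nontrivial.2 h,
        fun x hx y hy hxy => infsep_le_dist_of_mem hx hy hxy⟩
  have hnear := fun n => hfin.isCompact.exists_infDist_eq_dist hne (g^[k * n] c)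
  choose q hqO hq using hnear
  have hmul : Tendsto (fun n : ℕ => k * n) atTop atTop :=
    tendsto_id.const_mul_atTop' (by omega)
  have hlim : Tendsto (fun n => dist (g^[k * n] c) (q n)) atTop (nhds 0) := by
    simp only [← hq]
    exact hattract.comp hmul
  obtain ⟨ε, hε, hunif⟩ : ∃ ε > 0, ∀ r ∈ O, ∀ x ∈ I, dist x r < ε →
      dist (g^[k] x) r < d / 2 := by
    have : ∀ r ∈ O, ∃ ε > 0, ∀ x ∈ I, dist x r < ε → dist (g^[k] x) r < d / 2 := by
      intro r hr
      obtain ⟨ε, hε, h⟩ := Metric.continuousOn_iff.1 (hcontk k) r (hOI r hr) (d / 2) (half_pos hd)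
      rw [hOfix r hr] at h
      exact ⟨ε, hε, h⟩
    choose! ε hε h using this
    obtain ⟨m, hm, hmin⟩ := hfin.exists_minimalFor ε O hne
    refine ⟨ε m, hε m hm, fun r hr x hx hxr => h r hr x hx (hxr.trans_le ?_)⟩
    rcases le_total (ε m) (ε r) with h1 | h1
    · exact h1
    · exact hmin hr h1
  obtain ⟨n₀, hn₀⟩ := eventually_atTop.1
    (hlim.eventually (gt_mem_nhds (show 0 < min ε (d / 2) by positivity)))
  have hstep : ∀ n ≥ n₀, q (n + 1) = q n := by
    intro n hn
    by_contra hcon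
    have h1 := hunif (q n) (hqO n) _ (hmaps.iterate _ hc) ((hn₀ n hn).trans_le (min_le_left _ _))
    rw [← Function.iterate_add_apply, add_comm, ← mul_add_one] at h1
    have h2 := (hn₀ (n + 1) (by omega)).trans_le (min_le_right _ _)
    have h3 := dist_triangle_left (q (n + 1)) (q n) (g^[k * (n + 1)] c)
    have h4 := hdist _ (hqO (n + 1)) _ (hqO n) hcon
    linarith
  have hconst : ∀ n ≥ n₀, q n = q n₀ := by
    intro n hn
    induction n, hn using Nat.le_induction with
    | base => rfl
    | succ n hn ih => rw [hstep n hn, ih]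
  have hlimq : Tendsto (fun n => g^[k * n] c) atTop (nhds (q n₀)) := by
    rw [tendsto_iff_dist_tendsto_zero]
    refine hlim.congr' ?_
    filter_upwards [eventually_ge_atTop n₀] with n hn
    rw [hconst n hn]
  obtain ⟨i, hi, hiq⟩ := hqO n₀
  refine ⟨k - i, ?_⟩
  have hqI := hOI _ (hqO n₀)
  have h1 : Tendsto (fun n => g^[k - i] (g^[k * n] c)) atTop (nhds (g^[k - i] (q n₀))) := by
    refine ((hcontk (k - i)) _ hqI).tendsto.comp (tendsto_nhdsWithin_iff.2 ⟨hlimq, ?_⟩)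
    exact Eventually.of_forall fun n => hmaps.iterate _ hc
  rw [← hiq, ← Function.iterate_add_apply, Nat.sub_add_cancel hi.le, hper] at h1
  refine h1.congr fun n => ?_
  rw [← Function.iterate_add_apply, ← Function.iterate_add_apply, add_comm]

theorem exists_pos_le_of_forall_pos (u : ℕ → ℝ) (hu : ∀ j, 0 < u j) (m : ℕ) :
    ∃ e > 0, ∀ j < m, e ≤ u j := by
  induction m with
  | zero => exact ⟨1, one_pos, fun j hj => (Nat.not_lt_zero j hj).elim⟩
  | succ m ih =>
    obtain ⟨e, he, h⟩ := ih
    refine ⟨min e (u m), lt_min he (hu m), fun j hj => ?_⟩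
    rcases Nat.lt_succ_iff_lt_or_eq.1 hj with h1 | rfl
    · exact (min_le_left _ _).trans (h j h1)
    · exact min_le_right _ _

theorem ne_and_lt_iff_of_abs_sub_lt {x x' c c' : ℝ} (h : |x' - x| + |c' - c| < |x - c|) :
    x' ≠ c' ∧ (x' < c' ↔ x < c) := by
  have h1 := abs_le.1 (le_refl |x' - x|)
  have h2 := abs_le.1 (le_refl |c' - c|)
  rcases abs_cases (x - c) with ⟨h3, h4⟩ | ⟨h3, h4⟩ <;> rw [h3] at h
  · refine ⟨fun h5 => by linarith, fun h5 => by linarith, fun h5 => by linarith⟩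
  · refine ⟨fun h5 => by linarith, fun h5 => by linarith, fun h5 => by linarith⟩

set_option maxHeartbeats 1000000 in
/-- Near a parabolic parameter the critical orbit of `g_t` lies on the sides of the turning point
prescribed by the parabolic orbit for a time of order `t^(-1/2)`. -/
theorem exists_side_agreement (G : ℝ → ℝ → ℝ)
    (hC2 : ContDiffOn ℝ 2 (fun q : ℝ × ℝ => G q.1 q.2) (Icc (-1 : ℝ) 1 ×ˢ Icc (0 : ℝ) 1))
    (huni : ∀ t ∈ Icc (0 : ℝ) 1, ∃ ct, C2UnimodalWith (fun x => G x t) ct)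
    (c : ℝ) (hc : C2UnimodalWith (fun x => G x 0) c)
    (p : ℝ) (hp : p ∈ Icc (-1 : ℝ) 1) (k : ℕ) (hk : 1 ≤ k)
    (hper : (fun x => G x 0)^[k] p = p)
    (hmult : |deriv ((fun x => G x 0)^[k]) p| = 1)
    (hattract : Tendsto
      (fun n : ℕ => Metric.infDist ((fun x => G x 0)^[n] c)
        {y : ℝ | ∃ i < k, (fun x => G x 0)^[i] p = y}) atTop (nhds 0))
    (hdisj : ∀ n : ℕ, (fun x => G x 0)^[n] c ∉
      {y : ℝ | ∃ i < k, (fun x => G x 0)^[i] p = y}) :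
    ∃ a > 0, ∃ t₀, 0 < t₀ ∧ t₀ ≤ 1 ∧ ∃ M K : ℕ, 0 < K ∧ ∃ s : ℕ → Prop,
      (∀ n ≥ M, (s (n + K) ↔ s n)) ∧
      ∀ t ∈ Icc 0 t₀, ∀ ct, C2UnimodalWith (fun x => G x t) ct → ∀ n : ℕ, 1 ≤ n →
        n * Real.sqrt t ≤ a →
        (fun x => G x t)^[n] ct ≠ ct ∧ ((fun x => G x t)^[n] ct < ct ↔ s n) := by
  have hmaps : ∀ t ∈ Icc (0 : ℝ) 1,
      MapsTo (fun x => G x t) (Icc (-1 : ℝ) 1) (Icc (-1 : ℝ) 1) := fun t ht => by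
    obtain ⟨ct, h⟩ := huni t ht
    exact h.2.1
  have h0I : (0 : ℝ) ∈ Icc (0 : ℝ) 1 := ⟨le_rfl, zero_le_one⟩
  choose B hB HB using exists_abs_iterate_sub_le hC2 hmaps
  have hcI : c ∈ Icc (-1 : ℝ) 1 := ⟨hc.1.1.le, hc.1.2.le⟩
  have hg0C2 : ContDiffOn ℝ 2 (fun x => G x 0) (Icc (-1 : ℝ) 1) := hc.2.2.2.2.1
  have hcontG : ∃ C > 0, ∀ t ∈ Icc (0 : ℝ) 1, ∀ x ∈ Icc (-1 : ℝ) 1, |G x t - G x 0| ≤ C * t :=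
    ⟨B 1, hB 1, fun t ht x hx => by simpa using HB 1 t ht x hx x hx⟩
  set g : ℝ → ℝ := fun x => G x 0 with hg
  have hgm := hmaps 0 h0I
  set O : Set ℝ := {y : ℝ | ∃ i < k, g^[i] p = y} with hO
  have hgc_ne : ∀ n, 1 ≤ n → g^[n] c ≠ c := by
    intro n hn hnc
    have hfin : O.Finite := by
      have : O = (fun i => g^[i] p) '' Iio k := by
        ext y; simp [hO, mem_image]
      rw [this]
      exact (finite_Iio k).image _
    have hiter : ∀ m, g^[n * m] c = c := fun m => by
      rw [Function.iterate_mul]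
      exact Function.iterate_fixed hnc m
    have hlim := hattract.comp (tendsto_id.const_mul_atTop' (show 0 < n by omega))
    simp only [Function.comp_def, id, hiter] at hlim
    have hz := tendsto_nhds_unique hlim tendsto_const_nhds
    exact hdisj 0 ((hfin.isClosed.mem_iff_infDist_zero ⟨p, 0, hk, rfl⟩).2 hz.symm)
  have hgp_ne : ∀ j, g^[j] p ≠ c := by
    intro j hj
    refine hdisj 0 ⟨j % k, Nat.mod_lt _ hk, ?_⟩
    rw [Function.iterate_zero_apply, ← hj]
    conv_rhs => rw [← Nat.mod_add_div j k, Function.iterate_add_apply, Function.iterate_mul,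
      Function.iterate_fixed hper]
  obtain ⟨K, hK⟩ : ∃ K, K = 2 * k := ⟨_, rfl⟩
  have hK0 : 0 < K := by omega
  have hFp : g^[K] p = p := by rw [hK, two_mul, Function.iterate_add_apply, hper, hper]
  have hFd : HasDerivAt g^[K] 1 p := by
    have h1 : DifferentiableAt ℝ g^[k] p := by
      by_contra hcon
      rw [deriv_zero_of_not_differentiableAt hcon] at hmult
      norm_num at hmult
    have h2 := h1.hasDerivAt
    have h3 : HasDerivAt (g^[k] ∘ g^[k]) (deriv g^[k] p * deriv g^[k] p) p := by
      refine HasDerivAt.comp p ?_ h2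
      rw [hper]
      exact h2
    rwa [← Function.iterate_add, ← two_mul, ← hK, ← abs_mul_abs_self, hmult, one_mul] at h3
  obtain ⟨C₁, hC₁, hdis⟩ := exists_abs_displacement_sub_le (hg0C2.iterate_of_mapsTo hgm K) hp hFd
  set C := C₁ + B K with hCdef
  have hC : 0 < C := add_pos hC₁ (hB K)
  have hF : ∀ r, 0 ≤ r → ∀ x ∈ Icc (-1 : ℝ) 1, ∀ y ∈ Icc (-1 : ℝ) 1, |x - p| ≤ r → |y - p| ≤ r →
      |(g^[K] y - y) - (g^[K] x - x)| ≤ C * r * |y - x| := by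
    intro r hr x hx y hy hxr hyr
    refine (hdis r hr x hx y hy hxr hyr).trans ?_
    have := hB K
    gcongr
    linarith
  have hH : ∀ t ∈ Icc (0 : ℝ) 1, ∀ x ∈ Icc (-1 : ℝ) 1,
      |(fun x => G x t)^[K] x - g^[K] x| ≤ C * t := by
    intro t ht x hx
    refine (HB K t ht x hx x hx).trans ?_
    rw [sub_self, abs_zero, zero_add]
    have := ht.1
    gcongr
    linarith
  obtain ⟨M₀, hM₀⟩ := exists_tendsto_iterate_of_infDist hg0C2.continuousOn hgm hp hcI hk hper
    hattract
  have hlim : Tendsto (fun n => (g^[K])^[n] (g^[M₀] c)) atTop (nhds p) := by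
    refine (hM₀.comp (tendsto_id.const_mul_atTop' two_pos)).congr fun n => ?_
    simp only [Function.comp_def, id]
    rw [← Function.iterate_mul, hK, show 2 * k * n = k * (2 * n) by ring]
  have hiter : ∀ n, (g^[K])^[n] (g^[M₀] c) = g^[K * n + M₀] c := fun n => by
    rw [← Function.iterate_mul, Function.iterate_add_apply]
  have hne : ∀ n, (g^[K])^[n] (g^[M₀] c) ≠ p := fun n hn =>
    hdisj (K * n + M₀) ⟨0, hk, by rw [← hiter, hn]; rfl⟩
  obtain ⟨e₁, he₁, H₁⟩ := exists_pos_le_of_forall_pos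
    (fun j => |g^[j] p - c| / (2 * B j + 1)) (fun j => div_pos
      (abs_pos.2 (sub_ne_zero.2 (hgp_ne j))) (by have := hB j; positivity)) K
  obtain ⟨n₁, hn₁δ, hn₁C, hn₁lt, hn₁s⟩ := exists_abs_displaced_lt hC hF hp hFp (hgm.iterate K)
    (hgm.iterate M₀ hcI) hlim hne he₁
  obtain ⟨M, hM⟩ : ∃ M, M = K * (n₁ + 1) + M₀ := ⟨_, rfl⟩
  have hzsucc := Function.iterate_succ_apply' g^[K] n₁ (g^[M₀] c)
  have hz'M : (g^[K])^[n₁ + 1] (g^[M₀] c) = g^[M] c := by rw [hiter, hM]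
  have hzI : (g^[K])^[n₁] (g^[M₀] c) ∈ Icc (-1 : ℝ) 1 :=
    (hgm.iterate K).iterate n₁ (hgm.iterate M₀ hcI)
  have hzp := hne n₁
  have hz'p := hne (n₁ + 1)
  rw [hz'M] at hzsucc hn₁lt hn₁s hz'p
  set z := (g^[K])^[n₁] (g^[M₀] c)
  set z' := g^[M] c with hz'
  obtain ⟨e₂, he₂, H₂⟩ := exists_pos_le_of_forall_pos
    (fun n => |g^[n + 1] c - c| / (2 * B (n + 1) + 1)) (fun n => div_pos
      (abs_pos.2 (sub_ne_zero.2 (hgc_ne (n + 1) (by omega))))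
      (by have := hB (n + 1); positivity)) M
  have hgap : 0 < |z - p| - |z' - p| := sub_pos.2 hn₁lt
  have hz'pos : 0 < |z' - p| := abs_pos.2 (sub_ne_zero.2 hz'p)
  have hzpos : 0 < |z - p| := hz'pos.trans hn₁lt
  obtain ⟨e₃, he₃, h31, h32⟩ : ∃ e₃ > 0, 2 * B M * e₃ ≤ |z' - p| ∧
      2 * B M * e₃ ≤ |z - p| - |z' - p| := by
    have hBM := hB M
    refine ⟨min |z' - p| (|z - p| - |z' - p|) / (2 * B M), by positivity, ?_, ?_⟩
    · rw [mul_div_cancel₀ _ (by positivity)]; exact min_le_left _ _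
    · rw [mul_div_cancel₀ _ (by positivity)]; exact min_le_right _ _
  obtain ⟨e, he, hee₁, hee₂, hee₃⟩ : ∃ e > 0, e ≤ e₁ ∧ e ≤ e₂ ∧ e ≤ e₃ :=
    ⟨min e₁ (min e₂ e₃), by positivity, min_le_left _ _,
      (min_le_right _ _).trans (min_le_left _ _), (min_le_right _ _).trans (min_le_right _ _)⟩
  obtain ⟨δ, hδ, hδ1, hturn⟩ := exists_abs_turning_sub_lt hcontG hc he
  obtain ⟨t₀, ht₀, ht₀δ, ht₀e, ht₀C, ht₀z⟩ : ∃ t₀ > 0, t₀ ≤ δ ∧ t₀ ≤ e ∧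
      C * t₀ ≤ |z - p| - |z' - p| ∧ t₀ ≤ |z - p| ^ 2 := by
    refine ⟨min (min δ e) (min ((|z - p| - |z' - p|) / C) (|z - p| ^ 2)), by positivity,
      (min_le_left _ _).trans (min_le_left _ _), (min_le_left _ _).trans (min_le_right _ _), ?_,
      (min_le_right _ _).trans (min_le_right _ _)⟩
    have : min (min δ e) (min ((|z - p| - |z' - p|) / C) (|z - p| ^ 2)) ≤
      (|z - p| - |z' - p|) / C := (min_le_right _ _).trans (min_le_left _ _)
    rw [le_div_iff₀ hC] at this
    linarith
  refine ⟨1 / (2 * C), by positivity, t₀, ht₀, ht₀δ.trans hδ1, M, K, hK0,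
    fun n => if n < M then g^[n] c < c else g^[(n - M) % K] p < c, fun n hn => ?_, ?_⟩
  · beta_reduce
    rw [if_neg (by omega), if_neg (by omega), Nat.sub_add_comm hn, Nat.add_mod_right]
  intro t ht ct hct n hn1 hnt
  have ht1 : t ∈ Icc (0 : ℝ) 1 := ⟨ht.1, ht.2.trans (ht₀δ.trans hδ1)⟩
  have hctc := hturn t ⟨ht.1, ht.2.trans ht₀δ⟩ ct hct
  have hctI : ct ∈ Icc (-1 : ℝ) 1 := ⟨hct.1.1.le, hct.1.2.le⟩
  have hte := ht.2.trans ht₀e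
  have hdist : ∀ j, |(fun x => G x t)^[j] ct - g^[j] c| ≤ 2 * B j * e := fun j => by
    refine (HB j t ht1 ct hctI c hcI).trans ?_
    have := hB j
    rw [mul_comm 2 (B j), mul_assoc]
    gcongr
    linarith
  by_cases hnM : n < M
  · simp only [if_pos hnM]
    apply ne_and_lt_iff_of_abs_sub_lt
    obtain ⟨m, rfl⟩ := Nat.exists_eq_add_of_le' hn1
    have h1 := hee₂.trans (H₂ m (by omega))
    rw [le_div_iff₀ (by have := hB (m + 1); positivity)] at h1
    have h2 := hdist (m + 1)
    linarith
  · simp only [if_neg hnM]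
    apply ne_and_lt_iff_of_abs_sub_lt
    obtain ⟨j, hj⟩ : ∃ j, j = (n - M) % K := ⟨_, rfl⟩
    obtain ⟨m, hm⟩ : ∃ m, m = (n - M) / K := ⟨_, rfl⟩
    rw [← hj]
    have hjK : j < K := hj ▸ Nat.mod_lt _ hK0
    have hnjm : n = j + (K * m + M) := by
      have := Nat.mod_add_div (n - M) K
      rw [← hj, ← hm] at this
      omega
    have hmn : m ≤ n := hm ▸ (Nat.div_le_self _ _).trans (Nat.sub_le _ _)
    have hmt : 2 * C * m * Real.sqrt t ≤ 1 := by
      have h1 : (m : ℝ) * Real.sqrt t ≤ 1 / (2 * C) := le_trans (by gcongr) hnt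
      rw [le_div_iff₀ (by positivity)] at h1
      linarith
    have hwM := hdist M
    rw [← hz'] at hwM
    have hwM' : 2 * B M * e ≤ 2 * B M * e₃ := by
      have := hB M
      gcongr
    have hwI : (fun x => G x t)^[M] ct ∈ Icc (-1 : ℝ) 1 := (hmaps t ht1).iterate M hctI
    have key := abs_iterate_sub_le (H := (fun x => G x t)^[K]) (w := (fun x => G x t)^[M] ct) hC hF
      hp hFp ht1.1 (hH t ht1) ((hmaps t ht1).iterate K) hzI hzp hn₁C
      (by
        have h1 := abs_le.1 (hwM.trans (hwM'.trans h31))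
        rcases abs_cases (z' - p) with ⟨h2, h3⟩ | ⟨h2, h3⟩
        · have h4 : 0 < z - p := by
            by_contra! hcon
            nlinarith
          exact mul_nonneg (by linarith) h4.le
        · have h4 : z - p < 0 := by
            by_contra! hcon
            nlinarith
          exact mul_nonneg_of_nonpos_of_nonpos (by linarith) h4.le)
      (by rw [← hzsucc]; exact hn₁s.le)
      (by
        rw [← hzsucc]
        have : C * t ≤ C * t₀ := by gcongr; exact ht.2
        linarith)
      (by rw [Real.sqrt_le_left (abs_nonneg _)]; exact ht.2.trans ht₀z)
      hwI
      (by
        have h1 := abs_add_le ((fun x => G x t)^[M] ct - z') (z' - p)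
        rw [sub_add_sub_cancel] at h1
        linarith)
      m hmt
    rw [← Function.iterate_mul, ← Function.iterate_add_apply] at key
    have hwI' : (fun x => G x t)^[K * m + M] ct ∈ Icc (-1 : ℝ) 1 := (hmaps t ht1).iterate _ hctI
    have h1 := HB j t ht1 _ hwI' p hp
    rw [← Function.iterate_add_apply, ← hnjm] at h1
    have h2 := H₁ j hjK
    have hBj := hB j
    rw [le_div_iff₀ (by positivity)] at h2
    have h3 : B j * (|(fun x => G x t)^[K * m + M] ct - p| + t) ≤ B j * (2 * e₁) := by
      gcongr
      linarith
    nlinarith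

theorem entropyOn_neg_conj (f : ℝ → ℝ) :
    entropyOn (fun x => -f (-x)) (Icc (-1 : ℝ) 1) = entropyOn f (Icc (-1 : ℝ) 1) := by
  have himage : (fun x : ℝ => -x) '' Icc (-1 : ℝ) 1 = Icc (-1 : ℝ) 1 := by
    ext x
    constructor
    · rintro ⟨y, hy, rfl⟩
      exact ⟨by linarith [hy.2], by linarith [hy.1]⟩
    · intro hx
      exact ⟨-x, ⟨by linarith [hx.2], by linarith [hx.1]⟩, neg_neg x⟩
  have key : ∀ g : ℝ → ℝ, Dynamics.coverEntropy (fun x => -g (-x)) (Icc (-1 : ℝ) 1) ≤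
      Dynamics.coverEntropy g (Icc (-1 : ℝ) 1) := by
    intro g
    have h := Dynamics.coverEntropy_image_le_of_uniformContinuous (S := g)
      (T := fun x => -g (-x)) (φ := fun x : ℝ => -x) (fun x => by simp)
      uniformContinuous_neg (Icc (-1 : ℝ) 1)
    rwa [himage] at h
  unfold entropyOn
  congr 1
  refine le_antisymm (key f) ?_
  have h := key (fun x => -f (-x))
  simpa using h

theorem C2UnimodalWith.isUnimodalMax {f : ℝ → ℝ} {c : ℝ} (hf : C2UnimodalWith f c)
    (hl : f (-1) = -1) : IsUnimodalMax f c := by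
  obtain ⟨hc, hmaps, -, hr, hC2, -, hshape⟩ := hf
  have hcI : c ∈ Icc (-1 : ℝ) 1 := ⟨hc.1.le, hc.2.le⟩
  rcases hshape with ⟨h1, h2⟩ | ⟨h1, h2⟩
  · refine ⟨hc, hmaps, hC2.continuousOn, hl, hr.resolve_right fun h => ?_, h1, h2⟩
    have h3 := h2 ⟨le_rfl, hc.2.le⟩ ⟨hc.2.le, le_rfl⟩ hc.2
    have h4 := (hmaps hcI).2
    rw [mem_singleton_iff.1 h] at h3
    linarith
  · have h3 := h1 ⟨le_rfl, hc.1.le⟩ ⟨hc.1.le, le_rfl⟩ hc.1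
    have h4 := (hmaps hcI).1
    rw [hl] at h3
    linarith

theorem C2UnimodalWith.isUnimodalMax_neg_conj {f : ℝ → ℝ} {c : ℝ} (hf : C2UnimodalWith f c)
    (hl : f (-1) = 1) : IsUnimodalMax (fun x => -f (-x)) (-c) := by
  obtain ⟨hc, hmaps, -, hr, hC2, -, hshape⟩ := hf
  have hcI : c ∈ Icc (-1 : ℝ) 1 := ⟨hc.1.le, hc.2.le⟩
  have hneg : MapsTo (fun x : ℝ => -x) (Icc (-1 : ℝ) 1) (Icc (-1 : ℝ) 1) := fun x hx =>
    ⟨by linarith [hx.2], by linarith [hx.1]⟩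
  rcases hshape with ⟨h1, h2⟩ | ⟨h1, h2⟩
  · have h3 := h1 ⟨le_rfl, hc.1.le⟩ ⟨hc.1.le, le_rfl⟩ hc.1
    have h4 := (hmaps hcI).2
    rw [hl] at h3
    linarith
  · refine ⟨⟨by linarith [hc.2], by linarith [hc.1]⟩, hneg.comp (hmaps.comp hneg),
      (hC2.continuousOn.comp continuousOn_neg hneg).neg, ?_, ?_, ?_, ?_⟩
    · have h3 : f 1 = 1 := by
        rcases hr with h | h
        · have h3 := h2 ⟨le_rfl, hc.2.le⟩ ⟨hc.2.le, le_rfl⟩ hc.2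
          have h4 := (hmaps hcI).1
          rw [h] at h3
          linarith
        · exact h
      simp [h3]
    · simp [hl]
    · intro x hx y hy hxy
      exact neg_lt_neg (h2 ⟨by linarith [hy.2], by linarith [hy.1]⟩
        ⟨by linarith [hx.2], by linarith [hx.1]⟩ (neg_lt_neg hxy))
    · intro x hx y hy hxy
      exact neg_lt_neg (h1 ⟨by linarith [hy.2], by linarith [hy.1]⟩
        ⟨by linarith [hx.2], by linarith [hx.1]⟩ (neg_lt_neg hxy))

/-- If the critical orbits of the maps `g t` follow a common eventually periodic pattern for a time
of order `t^(-1/2)`, then the entropy is exponentially flat at `t = 0`. -/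
theorem entropyOn_flat_of_side_agreement {g : ℝ → ℝ → ℝ} {a t₀ : ℝ} (ha : 0 < a) (ht₀ : 0 < t₀)
    {M K : ℕ} (hK : 0 < K) {s : ℕ → Prop} (hs : ∀ n ≥ M, (s (n + K) ↔ s n))
    (hg : ∀ t ∈ Icc 0 t₀, ∃ ct, IsUnimodalMax (g t) ct ∧ ∀ n : ℕ, 1 ≤ n → n * Real.sqrt t ≤ a →
      (g t)^[n] ct ≠ ct ∧ ((g t)^[n] ct < ct ↔ s n)) :
    ∃ c₀ : ℝ, 0 < c₀ ∧ ∃ t₁ : ℝ, 0 < t₁ ∧ t₁ ≤ t₀ ∧ ∀ t ∈ Ioc (0 : ℝ) t₁,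
      |entropyOn (g t) (Icc (-1 : ℝ) 1) - entropyOn (g 0) (Icc (-1 : ℝ) 1)| ≤
        Real.exp (-(c₀ * t ^ (-(1 / 2) : ℝ))) := by
  obtain ⟨c, hf₀, hside₀⟩ := hg 0 ⟨le_rfl, ht₀.le⟩
  replace hside₀ := fun n hn => hside₀ n hn (by simpa using ha.le)
  have hTM := exists_not_doubling (M := M + 1) hK (fun n hn => (hside₀ n hn).1) fun n hn => by
    rw [(hside₀ (n + K) (by omega)).2, (hside₀ n (by omega)).2, hs n (by omega)]
  obtain ⟨C, hC, N₀, hN₀⟩ := hf₀.exists_abs_entropyOn_sub_le hTM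
  refine ⟨C * (a / 2), by positivity, min t₀ ((a / (N₀ + 2)) ^ 2), lt_min ht₀ (by positivity),
    min_le_left _ _, fun t ht => ?_⟩
  obtain ⟨ct, hf, hside⟩ := hg t ⟨ht.1.le, ht.2.trans (min_le_left _ _)⟩
  have hst : 0 < Real.sqrt t := Real.sqrt_pos.2 ht.1
  have hlarge : (N₀ : ℝ) + 2 ≤ a / Real.sqrt t := by
    have h1 : Real.sqrt t ≤ a / (N₀ + 2) := by
      rw [Real.sqrt_le_left (by positivity)]
      exact ht.2.trans (min_le_right _ _)
    rw [le_div_iff₀ (by positivity)] at h1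
    rw [le_div_iff₀ hst]
    linarith
  have hfloor := Nat.floor_le (show 0 ≤ a / Real.sqrt t by positivity)
  have hfloor' := Nat.lt_floor_add_one (a / Real.sqrt t)
  refine (hN₀ ⌊a / Real.sqrt t⌋₊ ?_ (g t) ct hf (kneadingSign_congr fun n hn hnN => ?_)).trans ?_
  · exact Nat.le_floor (by linarith)
  · have h1 : (n : ℝ) * Real.sqrt t ≤ a := by
      rw [← le_div_iff₀ hst]
      exact le_trans (by exact_mod_cast hnN) hfloor
    obtain ⟨h2, h3⟩ := hside n hn h1
    obtain ⟨h4, h5⟩ := hside₀ n hn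
    exact ⟨h2, h4, h3.trans h5.symm⟩
  · rw [Real.exp_le_exp, neg_le_neg_iff, Real.rpow_neg ht.1.le, ← Real.sqrt_eq_rpow, mul_assoc]
    refine mul_le_mul_of_nonneg_left ?_ hC.le
    have h1 : a / 2 * (Real.sqrt t)⁻¹ = a / Real.sqrt t / 2 := by ring
    have h2 : (0 : ℝ) ≤ N₀ := Nat.cast_nonneg _
    linarith

/-- Theorem (flatness estimate of entropy at parabolic parameters).
Let `G` be a C² family of C² unimodal maps `g_t` of `I = [-1,1]` such that `g_0` has a
parabolic periodic point `p` whose orbit attracts, but is disjoint from, the critical orbit.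
Then there exist `c₀ > 0` and `t₀ > 0` such that `|h(t) − h(0)| ≤ exp(−c₀ · t^{−1/2})` for all `t ∈ (0, t₀]`. -/
theorem entropy_exp_flat_at_parabolic
    (G : ℝ → ℝ → ℝ)
    -- G is C² on I × [0,1]
    (hC2 : ContDiffOn ℝ 2 (fun q : ℝ × ℝ => G q.1 q.2)
      (Set.Icc (-1 : ℝ) 1 ×ˢ Set.Icc (0 : ℝ) 1))
    -- each g_t is a C² unimodal map with some turning point c_t
    (huni : ∀ t ∈ Set.Icc (0 : ℝ) 1, ∃ ct, C2UnimodalWith (fun x => G x t) ct)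
    (c : ℝ) (hc : C2UnimodalWith (fun x => G x 0) c)
    -- parabolic periodic point of g_0
    (p : ℝ) (hp : p ∈ Set.Icc (-1 : ℝ) 1) (k : ℕ) (hk : 1 ≤ k)
    (hper : (fun x => G x 0)^[k] p = p)
    (hmult : |deriv ((fun x => G x 0)^[k]) p| = 1)
    -- the orbit of p attracts the critical orbit
    (hattract : Filter.Tendsto
      (fun n : ℕ => Metric.infDist ((fun x => G x 0)^[n] c)
        {y : ℝ | ∃ i < k, (fun x => G x 0)^[i] p = y})
      Filter.atTop (nhds 0))
    -- the critical orbit is disjoint from the orbit of p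
    (hdisj : ∀ n : ℕ, (fun x => G x 0)^[n] c ∉
      {y : ℝ | ∃ i < k, (fun x => G x 0)^[i] p = y}) :
    ∃ c₀ : ℝ, 0 < c₀ ∧ ∃ t₀ : ℝ, 0 < t₀ ∧ ∀ t ∈ Set.Ioc (0 : ℝ) t₀,
      |entropyOn (fun x => G x t) (Set.Icc (-1 : ℝ) 1) -
        entropyOn (fun x => G x 0) (Set.Icc (-1 : ℝ) 1)| ≤
          Real.exp (-(c₀ * t ^ (-(1 / 2) : ℝ))) := by
  obtain ⟨a, ha, t₀, ht₀, ht₀1, M, K, hK, s, hs, hside⟩ := exists_side_agreement G hC2 huni c hc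
    p hp k hk hper hmult hattract hdisj
  have hmaps : ∀ t ∈ Icc (0 : ℝ) 1,
      MapsTo (fun x => G x t) (Icc (-1 : ℝ) 1) (Icc (-1 : ℝ) 1) := fun t ht => by
    obtain ⟨ct, h⟩ := huni t ht
    exact h.2.1
  obtain ⟨B, hB, hlip⟩ := exists_abs_iterate_sub_le hC2 hmaps 1
  have hm1 : (-1 : ℝ) ∈ Icc (-1 : ℝ) 1 := ⟨le_rfl, by norm_num⟩
  obtain ⟨t₁, ht₁, ht₁t₀, hleft⟩ : ∃ t₁ > 0, t₁ ≤ t₀ ∧ ∀ t ∈ Icc 0 t₁, G (-1) t = G (-1) 0 := by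
    refine ⟨min t₀ (1 / B), lt_min ht₀ (by positivity), min_le_left _ _, fun t ht => ?_⟩
    have ht1 : t ∈ Icc (0 : ℝ) 1 := ⟨ht.1, (ht.2.trans (min_le_left _ _)).trans ht₀1⟩
    obtain ⟨ct, -, -, h1, -⟩ := huni t ht1
    have h2 := hc.2.2.1
    have h3 := hlip t ht1 (-1) hm1 (-1) hm1
    have h4 := ht.2.trans (min_le_right _ _)
    rw [le_div_iff₀ hB] at h4
    simp only [Function.iterate_one, sub_self, abs_zero, zero_add] at h3
    have h5 := abs_le.1 h3
    simp only [mem_insert_iff, mem_singleton_iff] at h1 h2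
    rcases h1 with h1 | h1 <;> rcases h2 with h2 | h2 <;> rw [h1, h2] at h5 ⊢ <;> linarith
  have hC2t : ∀ t ∈ Icc 0 t₁, ∃ ct, C2UnimodalWith (fun x => G x t) ct := fun t ht =>
    huni t ⟨ht.1, (ht.2.trans ht₁t₀).trans ht₀1⟩
  rcases hc.2.2.1 with h | h
  · obtain ⟨c₀, hc₀, t₂, ht₂, -, hmain⟩ := entropyOn_flat_of_side_agreement
      (g := fun t x => G x t) ha ht₁ hK hs fun t ht => by
        obtain ⟨ct, hct⟩ := hC2t t ht
        exact ⟨ct, hct.isUnimodalMax ((hleft t ht).trans h),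
          hside t ⟨ht.1, ht.2.trans ht₁t₀⟩ ct hct⟩
    exact ⟨c₀, hc₀, t₂, ht₂, hmain⟩
  · obtain ⟨c₀, hc₀, t₂, ht₂, -, hmain⟩ := entropyOn_flat_of_side_agreement
      (g := fun t x => -G (-x) t) (s := fun n => ¬ s n) ha ht₁ hK
      (fun n hn => not_congr (hs n hn)) fun t ht => by
        obtain ⟨ct, hct⟩ := hC2t t ht
        refine ⟨-ct, hct.isUnimodalMax_neg_conj ((hleft t ht).trans h), fun n hn hna => ?_⟩
        obtain ⟨h1, h2⟩ := hside t ⟨ht.1, ht.2.trans ht₁t₀⟩ ct hct n hn hna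
        rw [neg_conj_iterate (fun x => G x t), neg_neg, ← h2, neg_lt_neg_iff, not_lt]
        exact ⟨fun h3 => h1 (neg_injective h3), le_of_lt, fun h3 => h3.lt_of_ne h1.symm⟩
    refine ⟨c₀, hc₀, t₂, ht₂, fun t ht => ?_⟩
    have := hmain t ht
    rwa [entropyOn_neg_conj (fun x => G x t), entropyOn_neg_conj (fun x => G x 0)] at this
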